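/- Let n be a positive integer, let dim_* be one of dim_T, dim_H, dim_P, and let K be a compact metric space with d^n_*(K) > 0. Then the following are equivalent: (1) for a generic f ∈ C(K,ℝⁿ), R_*(f) equals the interior of f(K) and the interior of f(K) is dense in f(K); (2) R_*(f) is dense in f(K) for a generic f ∈ C(K,ℝⁿ); (3) d^n_*(U) = d^n_*(K) for every non-empty open set U ⊆ K. -/

import Mathlib

open Set Metric Filter Topology TopologicalSpace
open scoped ENNReal NNReal

noncomputable section

universe u

/-- `indBelow n X` means that the small inductive (topological) dimension of `X`
is at most `n - 1`; in particular `indBelow 0 X` means `X = ∅`. -/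
def indBelow : ℕ → ∀ (X : Type u) [TopologicalSpace X], Prop
  | 0, X, _ => IsEmpty X
  | n + 1, X, inst =>
      letI := inst
      ∀ (x : X) (U : Set X), IsOpen U → x ∈ U →
        ∃ V : Set X, IsOpen V ∧ x ∈ V ∧ V ⊆ U ∧ indBelow n ↥(frontier V)

/-- The small inductive (topological) dimension, with values in `EReal`:
`-1` for the empty space and `⊤` if there is no finite bound. -/
def indDim (X : Type u) [TopologicalSpace X] : EReal :=
  sInf {d : EReal | ∃ n : ℕ, indBelow n X ∧ d = (n : EReal) - 1}

variable {X : Type u} [MetricSpace X]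

/-- Topological dimension of a subset of a metric space. -/
def tdim (A : Set X) : EReal := indDim ↥A

open Classical in
/-- Hausdorff dimension of a subset of a metric space,
with the convention `dim ∅ = -1`. -/
def hdim (A : Set X) : EReal := if A = ∅ then -1 else ((dimH A : ℝ≥0∞) : EReal)

/-- A `δ`-packing of `A`: a countable family of pairwise disjoint closed balls
with centers in `A` and radii at most `δ`. -/
def IsPacking (A : Set X) (δ : ℝ≥0) (s : Set (X × ℝ≥0)) : Prop :=
  s.Countable ∧ (∀ p ∈ s, p.1 ∈ A ∧ p.2 ≤ δ) ∧
    s.Pairwise fun p q => Disjoint (closedBall p.1 (p.2 : ℝ)) (closedBall q.1 (q.2 : ℝ))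

/-- The packing pre-measure `P^h_δ(A)`. -/
def packPre (h : ℝ≥0 → ℝ≥0) (A : Set X) (δ : ℝ≥0) : ℝ≥0∞ :=
  ⨆ (s : Set (X × ℝ≥0)) (_ : IsPacking A δ s), ∑' p : s, ((h p.1.2 : ℝ≥0) : ℝ≥0∞)

/-- The packing pre-measure (packing number) `P^h₀(A) = lim_{δ → 0+} P^h_δ(A)`. -/
def packPre0 (h : ℝ≥0 → ℝ≥0) (A : Set X) : ℝ≥0∞ :=
  ⨅ (δ : ℝ≥0) (_ : 0 < δ), packPre h A δ

/-- The `h`-packing measure `𝒫^h(A)`. -/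
def packMeasure (h : ℝ≥0 → ℝ≥0) (A : Set X) : ℝ≥0∞ :=
  ⨅ (c : ℕ → Set X) (_ : A = ⋃ i, c i), ∑' i, packPre0 h (c i)

open Classical in
/-- The packing dimension, with the convention `dim ∅ = -1`. -/
def pdim (A : Set X) : EReal :=
  if A = ∅ then -1
  else max 0 (⨆ (s : ℝ≥0) (_ : packMeasure (fun r => r ^ (s : ℝ)) A = ∞), ((s : ℝ) : EReal))

/-- The restriction of the packing measure `𝒫^h` to `A` is σ-finite. -/
def PackSigmaFiniteOn (h : ℝ≥0 → ℝ≥0) (A : Set X) : Prop :=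
  ∃ c : ℕ → Set X, A ⊆ ⋃ i, c i ∧ ∀ i, packMeasure h (A ∩ c i) < ∞

/-- The generalized Hausdorff measure `ℋ^h(A)` associated to a gauge function `h`. -/
def hMeasure (h : ℝ≥0 → ℝ≥0) (A : Set X) : ℝ≥0∞ :=
  ⨆ (δ : ℝ≥0) (_ : 0 < δ),
    ⨅ (c : ℕ → Set X) (_ : A ⊆ ⋃ i, c i) (_ : ∀ i, EMetric.diam (c i) ≤ (δ : ℝ≥0∞)),
      ∑' i, ((h (EMetric.diam (c i)).toNNReal : ℝ≥0) : ℝ≥0∞)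

/-- `F` is an `F_σ` subset of the subspace `A`. -/
def IsFSigmaIn (F A : Set X) : Prop :=
  ∃ C : ℕ → Set X, (∀ i, IsClosed (C i)) ∧ F = ⋃ i, C i ∩ A

/-- `d^n_*(A) = inf {dim_*(A ∖ F) : F ⊆ A is F_σ in A and dim_T F ≤ n - 1}`. -/
def dStar (dim : Set X → EReal) (n : ℕ) (A : Set X) : EReal :=
  sInf {d : EReal |
    ∃ F : Set X, IsFSigmaIn F A ∧ tdim F ≤ (n : EReal) - 1 ∧ d = dim (A \ F)}

end

universe u

/-! ### Small inductive dimension -/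

lemma indBelow_zero_iff {X : Type*} [TopologicalSpace X] : indBelow 0 X ↔ IsEmpty X := Iff.rfl

lemma indBelow_succ_iff {m : ℕ} {X : Type*} [TopologicalSpace X] :
    indBelow (m + 1) X ↔ ∀ (x : X) (U : Set X), IsOpen U → x ∈ U →
      ∃ V : Set X, IsOpen V ∧ x ∈ V ∧ V ⊆ U ∧ indBelow m ↥(frontier V) := Iff.rfl

lemma indBelow_of_isEmpty (m : ℕ) {X : Type*} [TopologicalSpace X] [IsEmpty X] :
    indBelow m X := by
  cases m with
  | zero => exact indBelow_zero_iff.2 ‹_›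
  | succ m => exact indBelow_succ_iff.2 fun x => isEmptyElim x

lemma indBelow.succ {m : ℕ} {X : Type u} [TopologicalSpace X] (h : indBelow m X) :
    indBelow (m + 1) X := by
  induction m generalizing X with
  | zero =>
    have : IsEmpty X := h
    exact indBelow_of_isEmpty _
  | succ m ih =>
    rw [indBelow_succ_iff] at h ⊢
    intro x U hU hx
    obtain ⟨V, hV, hxV, hVU, hf⟩ := h x U hU hx
    exact ⟨V, hV, hxV, hVU, ih hf⟩

lemma indBelow.mono {m k : ℕ} (hmk : m ≤ k) {X : Type u} [TopologicalSpace X]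
    (h : indBelow m X) : indBelow k X := by
  induction k, hmk using Nat.le_induction with
  | base => exact h
  | succ k _ ih => exact ih.succ

lemma indBelow.of_isInducing {m : ℕ} {X Y : Type u} [TopologicalSpace X] [TopologicalSpace Y]
    {e : X → Y} (he : IsInducing e) (h : indBelow m Y) : indBelow m X := by
  induction m generalizing X Y with
  | zero =>
    have : IsEmpty Y := h
    exact indBelow_zero_iff.2 (Function.isEmpty e)
  | succ m ih =>
    rw [indBelow_succ_iff] at h ⊢
    intro x U hU hx
    obtain ⟨U', hU', rfl⟩ := he.isOpen_iff.1 hU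
    obtain ⟨V, hV, hxV, hVU, hf⟩ := h (e x) U' hU' hx
    refine ⟨e ⁻¹' V, hV.preimage he.continuous, hxV, preimage_mono hVU, ?_⟩
    have hmap : MapsTo e (frontier (e ⁻¹' V)) (frontier V) :=
      he.continuous.frontier_preimage_subset V
    refine ih (e := hmap.restrict) ?_ hf
    have h1 : IsInducing (Subtype.val ∘ hmap.restrict) := he.comp IsInducing.subtypeVal
    exact IsInducing.of_comp_iff IsInducing.subtypeVal |>.1 h1

lemma indBelow.subset {m : ℕ} {X : Type u} [TopologicalSpace X] {A B : Set X} (hAB : A ⊆ B)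
    (h : indBelow m ↥B) : indBelow m ↥A :=
  h.of_isInducing (IsEmbedding.inclusion hAB).isInducing

lemma indBelow_of_indDim_le {m : ℕ} {X : Type*} [TopologicalSpace X]
    (h : indDim X ≤ (m : EReal) - 1) : indBelow m X := by
  by_contra hm
  have h1 : ((m : EReal)) ≤ indDim X := by
    refine le_sInf ?_
    rintro d ⟨k, hk, rfl⟩
    have : m < k := by
      by_contra hle
      exact hm (hk.mono (not_lt.1 hle))
    obtain ⟨j, rfl⟩ := Nat.exists_eq_add_of_lt this
    have e : ((m + j + 1 : ℕ) : EReal) - 1 = ((m + j : ℕ) : EReal) := by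
      have h1 : ((m + j + 1 : ℕ) : EReal) = (((m + j + 1 : ℕ) : ℝ) : EReal) := rfl
      have h2 : ((m + j : ℕ) : EReal) = (((m + j : ℕ) : ℝ) : EReal) := rfl
      have h3 : (1 : EReal) = ((1 : ℝ) : EReal) := rfl
      rw [h1, h2, h3, ← EReal.coe_sub, Nat.cast_succ, add_sub_cancel_right]
    rw [e]
    exact_mod_cast Nat.le_add_right m j
  have h2 : (m : EReal) - 1 < m := by
    have h1 : (m : EReal) = ((m : ℝ) : EReal) := rfl
    have h3 : (1 : EReal) = ((1 : ℝ) : EReal) := rfl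
    rw [h1, h3, ← EReal.coe_sub]
    exact EReal.coe_lt_coe_iff.2 (sub_one_lt _)
  exact absurd (h1.trans h) (not_le.2 h2)

lemma indBelow.indDim_le {m : ℕ} {X : Type*} [TopologicalSpace X]
    (h : indBelow m X) : indDim X ≤ (m : EReal) - 1 := sInf_le ⟨m, h, rfl⟩

lemma tdim_le_iff {X : Type*} [MetricSpace X] {A : Set X} {m : ℕ} :
    tdim A ≤ (m : EReal) - 1 ↔ indBelow m ↥A :=
  ⟨indBelow_of_indDim_le, indBelow.indDim_le⟩

lemma tdim_mono {X : Type*} [MetricSpace X] {A B : Set X} (h : A ⊆ B) : tdim A ≤ tdim B :=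
  le_sInf fun _ ⟨k, hk, hd⟩ => sInf_le ⟨k, hk.subset h, hd⟩

/-! ### Perturbations of continuous maps -/

lemma eventually_residual_of_dense_balls {E : Type*} [MetricSpace E] {P : E → Prop}
    (h : ∀ f : E, ∀ ε > 0, ∃ f', dist f' f < ε ∧ ∃ η > 0, ∀ g, dist g f' < η → P g) :
    ∀ᶠ g in residual E, P g := by
  have ho : IsOpen (interior {g | P g}) := isOpen_interior
  have hd : Dense (interior {g | P g}) := by
    rw [Metric.dense_iff]
    intro f ε hε
    obtain ⟨f', hf', η, hη, hg⟩ := h f ε hε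
    refine ⟨f', hf', mem_interior_iff_mem_nhds.2 ?_⟩
    exact Filter.mem_of_superset (ball_mem_nhds f' hη) fun g hgg => hg g hgg
  exact Filter.mem_of_superset (residual_of_dense_open ho hd) interior_subset

lemma eventually_sub_ne {N : ℕ} (a : Fin N → ℝ) (v : ℝ) :
    ∀ᶠ t in 𝓝[>] (0 : ℝ), ∀ j k, j ≠ k →
      (a j + t * ((j : ℕ) : ℝ)) - (a k + t * ((k : ℕ) : ℝ)) ≠ v := by
  refine eventually_all.2 fun j => eventually_all.2 fun k => ?_
  by_cases hjk : j = k
  · exact Eventually.of_forall fun t h => absurd hjk h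
  have hne : (((j : ℕ) : ℝ) - ((k : ℕ) : ℝ)) ≠ 0 := by
    rw [sub_ne_zero]
    exact fun h => hjk (Fin.ext (by exact_mod_cast h))
  set p : ℝ := (v - (a j - a k)) / (((j : ℕ) : ℝ) - ((k : ℕ) : ℝ)) with hp
  have hev : ∀ᶠ t in 𝓝[>] (0 : ℝ), t ≠ p := by
    by_cases hp0 : p = 0
    · filter_upwards [self_mem_nhdsWithin] with t ht
      rw [hp0]
      exact ne_of_gt ht
    · exact mem_nhdsWithin_of_mem_nhds (isOpen_ne.mem_nhds (Ne.symm hp0))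
  filter_upwards [hev] with t ht _ hv
  apply ht
  rw [hp, eq_div_iff hne]
  linarith

section Perturbation

variable {K : Type*} [MetricSpace K]

/-- A continuous function can be redefined on finitely many disjoint closed sets without
moving further than the prescribed values do. -/
lemma exists_glue_real {ι : Type*} [Finite ι] {D : ι → Set K} (hD : ∀ i, IsClosed (D i))
    (hdisj : Pairwise fun i j => Disjoint (D i) (D j)) (u : ι → C(K, ℝ)) (f : C(K, ℝ))
    {ε : ℝ} (hε : 0 ≤ ε) (hu : ∀ i, ∀ x ∈ D i, |u i x - f x| ≤ ε) :
    ∃ f' : C(K, ℝ), (∀ i, ∀ x ∈ D i, f' x = u i x) ∧ ∀ x, |f' x - f x| ≤ ε := by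
  classical
  set s : Set K := ⋃ i, D i with hs
  have hsc : IsClosed s := isClosed_iUnion_of_finite hD
  set g : K → ℝ := fun x => if h : ∃ i, x ∈ D i then u h.choose x - f x else 0 with hg
  have hgD : ∀ i, ∀ x ∈ D i, g x = u i x - f x := by
    intro i x hx
    have h : ∃ i, x ∈ D i := ⟨i, hx⟩
    have : h.choose = i := by
      by_contra hne
      exact (Set.disjoint_left.1 (hdisj hne) h.choose_spec) hx
    simp only [hg, dif_pos h, this]
  have hgc : ContinuousOn g s := by
    refine (locallyFinite_of_finite D).continuousOn_iUnion hD fun i => ?_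
    have : ContinuousOn (fun x => u i x - f x) (D i) := by fun_prop
    exact this.congr (hgD i)
  have hgb : ∀ x ∈ s, g x ∈ Icc (-ε) ε := by
    intro x hx
    obtain ⟨i, hi⟩ := mem_iUnion.1 hx
    rw [hgD i x hi]
    exact abs_le.1 (hu i x hi)
  obtain ⟨G, hG, hGr⟩ := ContinuousMap.exists_restrict_eq_forall_mem_of_closed
    (⟨s.domRestrict g, continuousOn_iff_continuous_domRestrict.1 hgc⟩ : C(s, ℝ))
    (t := Icc (-ε) ε) (fun x => hgb x x.2) ⟨0, by constructor <;> linarith⟩ hsc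
  refine ⟨f + G, fun i x hx => ?_, fun x => ?_⟩
  · have hxs : x ∈ s := mem_iUnion.2 ⟨i, hx⟩
    have : G x = g x := by
      exact congrArg (fun h : C(s, ℝ) => h ⟨x, hxs⟩) hGr
    rw [ContinuousMap.add_apply, this, hgD i x hx]
    ring
  · rw [ContinuousMap.add_apply, add_sub_cancel_left]
    exact abs_le.2 (hG x)

lemma exists_glue_pi {n : ℕ} {ι : Type*} [Finite ι] {D : ι → Set K} (hD : ∀ i, IsClosed (D i))
    (hdisj : Pairwise fun i j => Disjoint (D i) (D j)) (u : ι → C(K, Fin n → ℝ))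
    (f : C(K, Fin n → ℝ)) {ε : ℝ} (hε : 0 ≤ ε) (hu : ∀ i, ∀ x ∈ D i, dist (u i x) (f x) ≤ ε) :
    ∃ f' : C(K, Fin n → ℝ), (∀ i, ∀ x ∈ D i, f' x = u i x) ∧ ∀ x, dist (f' x) (f x) ≤ ε := by
  have h : ∀ a : Fin n, ∃ f' : C(K, ℝ), (∀ i, ∀ x ∈ D i, f' x = u i x a) ∧
      ∀ x, |f' x - f x a| ≤ ε := by
    intro a
    exact exists_glue_real hD hdisj (fun i => ⟨fun x => u i x a, by fun_prop⟩)
      ⟨fun x => f x a, by fun_prop⟩ hε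
      fun i x hx => (dist_le_pi_dist (u i x) (f x) a).trans (hu i x hx)
  choose F hF1 hF2 using h
  refine ⟨⟨fun x a => F a x, by fun_prop⟩, fun i x hx => ?_, fun x => ?_⟩
  · ext a
    exact hF1 a i x hx
  · exact (dist_pi_le_iff hε).2 fun a => hF2 a x

end Perturbation

/-! ### Unstable values and coloured covers -/

/-- The maps into `ℝⁿ` without zeros in `A` are dense. -/
def Avoids {K : Type*} [MetricSpace K] [CompactSpace K] (n : ℕ) (A : Set K) : Prop :=
  Dense {g : C(K, Fin n → ℝ) | ∀ x ∈ A, g x ≠ 0}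

/-- `A` is covered by `n` finite disjoint families of open sets of arbitrarily small diameter. -/
def HasColorCovers {K : Type*} [MetricSpace K] (n : ℕ) (A : Set K) : Prop :=
  ∀ ε > 0, ∃ (N : ℕ) (V : Fin n → Fin N → Set K), (∀ i j, IsOpen (V i j)) ∧
    (∀ i, Pairwise fun j k => Disjoint (V i j) (V i k)) ∧
    (∀ i j, ∀ x ∈ V i j, ∀ y ∈ V i j, dist x y < ε) ∧ A ⊆ ⋃ i, ⋃ j, V i j

section Avoids

variable {K : Type*} [MetricSpace K]

lemma HasColorCovers.of_finite {n : ℕ} {A : Set K}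
    (h : ∀ ε > 0, ∃ (ι : Type) (_ : Finite ι) (V : Fin n → ι → Set K), (∀ i j, IsOpen (V i j)) ∧
      (∀ i, Pairwise fun j k => Disjoint (V i j) (V i k)) ∧
      (∀ i j, ∀ x ∈ V i j, ∀ y ∈ V i j, dist x y < ε) ∧ A ⊆ ⋃ i, ⋃ j, V i j) :
    HasColorCovers n A := by
  intro ε hε
  obtain ⟨ι, hι, V, h1, h2, h3, h4⟩ := h ε hε
  obtain ⟨N, ⟨e⟩⟩ := Finite.exists_equiv_fin ι
  refine ⟨N, fun i j => V i (e.symm j), fun i j => h1 _ _, fun i j k hjk => ?_,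
    fun i j => h3 _ _, fun x hx => ?_⟩
  · exact h2 i (e.symm.injective.ne hjk)
  · obtain ⟨i, hi⟩ := mem_iUnion.1 (h4 hx)
    obtain ⟨j, hj⟩ := mem_iUnion.1 hi
    exact mem_iUnion.2 ⟨i, mem_iUnion.2 ⟨e j, by simpa using hj⟩⟩

lemma HasColorCovers.exists_closed {n : ℕ} {A : Set K} (h : HasColorCovers n A)
    (hA : IsClosed A) {ε : ℝ} (hε : 0 < ε) :
    ∃ (N : ℕ) (D : Fin n → Fin N → Set K), (∀ i j, IsClosed (D i j)) ∧
    (∀ i, Pairwise fun j k => Disjoint (D i j) (D i k)) ∧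
    (∀ i j, ∀ x ∈ D i j, ∀ y ∈ D i j, dist x y < ε) ∧ A ⊆ ⋃ i, ⋃ j, D i j := by
  obtain ⟨N, V, h1, h2, h3, h4⟩ := h ε hε
  have h4' : A ⊆ ⋃ p : Fin n × Fin N, V p.1 p.2 := by
    intro x hx
    obtain ⟨i, hi⟩ := mem_iUnion.1 (h4 hx)
    obtain ⟨j, hj⟩ := mem_iUnion.1 hi
    exact mem_iUnion.2 ⟨(i, j), hj⟩
  obtain ⟨v, hv1, hv2, hv3⟩ := exists_subset_iUnion_closed_subset hA
    (fun p : Fin n × Fin N => h1 p.1 p.2) (fun x _ => Set.toFinite _) h4'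
  refine ⟨N, fun i j => v (i, j), fun i j => hv2 _, fun i j k hjk => ?_, fun i j x hx y hy => ?_,
    fun x hx => ?_⟩
  · exact (h2 i hjk).mono (hv3 (i, j)) (hv3 (i, k))
  · exact h3 i j x (hv3 (i, j) hx) y (hv3 (i, j) hy)
  · obtain ⟨⟨i, j⟩, hp⟩ := mem_iUnion.1 (hv1 hx)
    exact mem_iUnion.2 ⟨i, mem_iUnion.2 ⟨j, hp⟩⟩

lemma isOpen_setOf_avoids {n : ℕ} {A : Set K} (hA : IsCompact A) :
    IsOpen {g : C(K, Fin n → ℝ) | ∀ x ∈ A, g x ≠ 0} :=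
  ContinuousMap.isOpen_setOfPred_mapsTo (U := {y : Fin n → ℝ | y ≠ 0}) hA isOpen_ne

variable [CompactSpace K]

lemma Avoids.mono {n : ℕ} {A B : Set K} (hAB : A ⊆ B) (h : Avoids n B) : Avoids n A :=
  Dense.mono (fun g (hg : ∀ x ∈ B, g x ≠ 0) x hx => hg x (hAB hx)) h

lemma Avoids.eventually_residual {n : ℕ} {A : Set K} (hA : IsCompact A) (h : Avoids n A) :
    ∀ᶠ g in residual C(K, Fin n → ℝ), ∀ x ∈ A, g x ≠ 0 :=
  residual_of_dense_open (isOpen_setOf_avoids hA) h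

lemma Avoids.iUnion {n : ℕ} {ι : Type*} [Countable ι] {A : ι → Set K}
    (hA : ∀ i, IsCompact (A i)) (h : ∀ i, Avoids n (A i)) : Avoids n (⋃ i, A i) := by
  have h1 : ∀ᶠ g in residual C(K, Fin n → ℝ), ∀ i, ∀ x ∈ A i, g x ≠ 0 :=
    eventually_countable_forall.2 fun i => (h i).eventually_residual (hA i)
  refine (dense_of_mem_residual h1).mono fun g hg x hx => ?_
  obtain ⟨i, hi⟩ := mem_iUnion.1 hx
  exact hg i x hi

/-- Generically, the coordinates indexed by `T` do not all agree at any point of `B`. -/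
lemma Avoids.eventually_coordinates_ne {n m : ℕ} {B : Set K} (hB : IsCompact B)
    (h : Avoids n B) (T : Fin (n + 1) ↪ Fin m) :
    ∀ᶠ μ in residual C(K, Fin m → ℝ), ∀ x ∈ B, ∃ a, μ x (T a) ≠ μ x (T 0) := by
  set L : C(K, Fin m → ℝ) → C(K, Fin n → ℝ) := fun μ =>
    ⟨fun x a => μ x (T a.succ) - μ x (T 0), by fun_prop⟩ with hL
  have hLd : ∀ μ μ', dist (L μ) (L μ') ≤ 2 * dist μ μ' := by
    intro μ μ'
    refine (ContinuousMap.dist_le (by positivity)).2 fun x =>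
      (dist_pi_le_iff (by positivity)).2 fun a => ?_
    have h1 := (dist_le_pi_dist (μ x) (μ' x) (T a.succ)).trans (ContinuousMap.dist_apply_le_dist x)
    have h2 := (dist_le_pi_dist (μ x) (μ' x) (T 0)).trans (ContinuousMap.dist_apply_le_dist x)
    rw [Real.dist_eq] at h1 h2 ⊢
    simp only [hL, ContinuousMap.coe_mk]
    rw [abs_le] at h1 h2 ⊢
    constructor <;> linarith [h1.1, h1.2, h2.1, h2.2]
  refine eventually_residual_of_dense_balls fun μ ε hε => ?_
  obtain ⟨g, hgB, hg⟩ := h.exists_dist_lt (L μ) (half_pos hε)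
  classical
  set μ' : C(K, Fin m → ℝ) :=
    ⟨fun x k => μ x k + ∑ a : Fin n, if T a.succ = k then g x a - L μ x a else 0, by
      refine continuous_pi fun k => ?_
      refine Continuous.add (by fun_prop) (continuous_finsetSum _ fun a _ => ?_)
      split_ifs <;> fun_prop⟩ with hμ'
  have hL' : L μ' = g := by
    ext x a
    have e1 : μ' x (T a.succ) = μ x (T a.succ) + (g x a - L μ x a) := by
      simp [hμ', T.injective.eq_iff, Finset.sum_ite_eq']
    have e2 : μ' x (T 0) = μ x (T 0) := by
      simp [hμ', T.injective.eq_iff, Fin.succ_ne_zero]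
    change μ' x (T a.succ) - μ' x (T 0) = g x a
    rw [e1, e2]
    simp only [hL, ContinuousMap.coe_mk]
    ring
  have hd : dist μ' μ ≤ ε / 2 := by
    refine (ContinuousMap.dist_le (by positivity)).2 fun x =>
      (dist_pi_le_iff (by positivity)).2 fun k => ?_
    have hb : ∀ a, |g x a - L μ x a| ≤ ε / 2 := by
      intro a
      rw [← Real.dist_eq, dist_comm]
      exact ((dist_le_pi_dist (L μ x) (g x) a).trans (ContinuousMap.dist_apply_le_dist x)).trans hg.le
    rw [Real.dist_eq]
    simp only [hμ', ContinuousMap.coe_mk, add_sub_cancel_left]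
    by_cases hk : ∃ a : Fin n, T a.succ = k
    · obtain ⟨a, rfl⟩ := hk
      simpa [T.injective.eq_iff, Finset.sum_ite_eq'] using hb a
    · rw [Finset.sum_eq_zero]
      · simpa using by positivity
      · intro a _
        exact if_neg fun hh => hk ⟨a, hh⟩
  refine ⟨μ', by linarith, ?_⟩
  obtain ⟨η, hη, hball⟩ := Metric.isOpen_iff.1 (isOpen_setOf_avoids (n := n) hB) g hgB
  refine ⟨η / 2, by positivity, fun ν hν x hx => ?_⟩
  have h1 : L ν ∈ ball g η := by
    rw [mem_ball, ← hL']
    linarith [hLd ν μ']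
  have h2 : L ν x ≠ 0 := hball h1 x hx
  by_contra hcon
  push Not at hcon
  apply h2
  ext a
  simp only [hL, ContinuousMap.coe_mk, hcon a.succ, sub_self, Pi.zero_apply]

lemma Avoids.hasColorCovers {n : ℕ} {B : Set K} (hB : IsCompact B) (h : Avoids n B) :
    HasColorCovers n B := by
  classical
  refine HasColorCovers.of_finite fun ε hε => ?_
  obtain ⟨t, -, htf, htc⟩ := finite_cover_balls_of_compact hB (e := ε / 4) (by positivity)
  obtain ⟨m, ⟨e⟩⟩ := Finite.exists_equiv_fin (h := htf.to_subtype)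
  set p : Fin m → K := fun j => (e.symm j : K) with hp
  have hpB : ∀ x ∈ B, ∃ j, dist x (p j) < ε / 4 := by
    intro x hx
    obtain ⟨y, hy, hxy⟩ := mem_iUnion₂.1 (htc hx)
    exact ⟨e ⟨y, hy⟩, by simpa [hp] using hxy⟩
  set lam : C(K, Fin m → ℝ) := ⟨fun x j => ε / 2 - dist x (p j), by fun_prop⟩ with hlam
  have hgen : ∀ᶠ μ in residual C(K, Fin m → ℝ), ∀ T : Fin (n + 1) ↪ Fin m,
      ∀ x ∈ B, ∃ a, μ x (T a) ≠ μ x (T 0) :=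
    eventually_countable_forall.2 fun T => h.eventually_coordinates_ne hB T
  obtain ⟨μ, hμ, hμd⟩ := (dense_of_mem_residual hgen).exists_dist_lt lam (ε := ε / 16)
    (by positivity)
  have hclose : ∀ x j, |lam x j - μ x j| < ε / 16 := fun x j =>
    ((dist_le_pi_dist (lam x) (μ x) j).trans (ContinuousMap.dist_apply_le_dist x)).trans_lt hμd
  have hlamv : ∀ x j, lam x j = ε / 2 - dist x (p j) := fun x j => rfl
  have hsmall : ∀ x j, ε / 8 < μ x j → dist x (p j) < ε / 2 := by
    intro x j hj
    have := (abs_lt.1 (hclose x j)).1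
    rw [hlamv] at this
    linarith
  have hbig : ∀ x ∈ B, ∃ j, ε / 8 < μ x j := by
    intro x hx
    obtain ⟨j, hj⟩ := hpB x hx
    refine ⟨j, ?_⟩
    have := (abs_lt.1 (hclose x j)).2
    rw [hlamv] at this
    linarith
  set V : Fin n → Finset (Fin m) → Set K := fun i S => if S.card = (i : ℕ) + 1 then
    ⋂ j ∈ S, ({x | ε / 8 < μ x j} ∩ ⋂ k ∈ Sᶜ, {x | μ x k < μ x j}) else ∅ with hV
  have hVmem : ∀ i S x, x ∈ V i S ↔ S.card = (i : ℕ) + 1 ∧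
      ∀ j ∈ S, ε / 8 < μ x j ∧ ∀ k ∉ S, μ x k < μ x j := by
    intro i S x
    by_cases hc : S.card = (i : ℕ) + 1 <;> simp [hV, hc]
  refine ⟨Finset (Fin m), inferInstance, V, fun i S => ?_, fun i S S' hSS => ?_,
    fun i S x hx y hy => ?_, fun x hx => ?_⟩
  · by_cases hc : S.card = (i : ℕ) + 1
    · simp only [hV, hc, if_true]
      refine isOpen_biInter_finset fun j _ => IsOpen.inter ?_ (isOpen_biInter_finset fun k _ => ?_)
      · exact isOpen_lt (by fun_prop) (by fun_prop)
      · exact isOpen_lt (by fun_prop) (by fun_prop)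
    · simp [hV, hc]
  · refine Set.disjoint_left.2 fun x hx hx' => ?_
    rw [hVmem] at hx hx'
    have hne : ¬ S ⊆ S' := fun hs => hSS (Finset.eq_of_subset_of_card_le hs (by omega))
    have hne' : ¬ S' ⊆ S := fun hs => hSS (Finset.eq_of_subset_of_card_le hs (by omega)).symm
    obtain ⟨j, hj, hj'⟩ := Finset.not_subset.1 hne
    obtain ⟨k, hk, hk'⟩ := Finset.not_subset.1 hne'
    exact lt_asymm ((hx.2 j hj).2 k hk') ((hx'.2 k hk).2 j hj')
  · rw [hVmem] at hx hy
    have hne : S.Nonempty := Finset.card_pos.1 (by omega)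
    obtain ⟨j, hj⟩ := hne
    have h1 := hsmall x j (hx.2 j hj).1
    have h2 := hsmall y j (hy.2 j hj).1
    linarith [dist_triangle_right x y (p j)]
  · obtain ⟨j₁, hj₁⟩ := hbig x hx
    obtain ⟨j₀, -, hj₀⟩ := Finset.exists_max_image Finset.univ (fun j => μ x j) ⟨j₁, Finset.mem_univ _⟩
    set S : Finset (Fin m) := Finset.univ.filter fun j => μ x j = μ x j₀ with hS
    have hj₀S : j₀ ∈ S := by simp [hS]
    have hcard : S.card ≤ n := by
      by_contra hcon
      have hc : n + 1 ≤ S.card := by omega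
      obtain ⟨S', hS'S, hS'c⟩ := Finset.exists_subset_card_eq hc
      set T : Fin (n + 1) ↪ Fin m := (S'.orderEmbOfFin hS'c).toEmbedding
      have hT : ∀ a, μ x (T a) = μ x j₀ := fun a =>
        (Finset.mem_filter.1 (hS'S (Finset.orderEmbOfFin_mem S' hS'c a))).2
      obtain ⟨a, ha⟩ := hμ T x hx
      exact ha ((hT a).trans (hT 0).symm)
    have hpos : 0 < S.card := Finset.card_pos.2 ⟨j₀, hj₀S⟩
    refine mem_iUnion.2 ⟨⟨S.card - 1, by omega⟩, mem_iUnion.2 ⟨S, (hVmem _ _ _).2 ⟨?_, ?_⟩⟩⟩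
    · simp only
      omega
    · intro j hj
      have hj' : μ x j = μ x j₀ := (Finset.mem_filter.1 hj).2
      rw [hj']
      refine ⟨hj₁.trans_le (hj₀ j₁ (Finset.mem_univ _)), fun k hk => ?_⟩
      refine lt_of_le_of_ne (hj₀ k (Finset.mem_univ _)) fun hh => hk ?_
      simp [hS, hh]

end Avoids

section DimensionAvoids

variable {K : Type*} [MetricSpace K] [CompactSpace K]

lemma exists_ne_zero_on_colors {n : ℕ} (f : C(K, Fin n → ℝ)) {ε : ℝ} (hε : 0 < ε) :
    ∃ δ > 0, ∀ (N : ℕ) (D : Fin n → Fin N → Set K), (∀ i j, IsClosed (D i j)) →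
      (∀ i, Pairwise fun j k => Disjoint (D i j) (D i k)) →
      (∀ i j, ∀ x ∈ D i j, ∀ y ∈ D i j, dist x y < δ) →
      ∃ f' : C(K, Fin n → ℝ), dist f' f < ε ∧ ∀ i j, ∀ x ∈ D i j, f' x i ≠ 0 := by
  obtain ⟨δ, hδ, hf⟩ := Metric.uniformContinuous_iff.1
    (CompactSpace.uniformContinuous_of_continuous f.continuous) (ε / 4) (by positivity)
  refine ⟨δ, hδ, fun N D h1 h2 h3 => ?_⟩
  have hv : ∀ i j, ∃ v : ℝ, v ≠ 0 ∧ ∀ x ∈ D i j, |v - f x i| ≤ ε / 2 := by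
    intro i j
    rcases (D i j).eq_empty_or_nonempty with he | ⟨p, hp⟩
    · exact ⟨1, one_ne_zero, by simp [he]⟩
    obtain ⟨v, hv0, hv⟩ : ∃ v : ℝ, v ≠ 0 ∧ |v - f p i| ≤ ε / 4 := by
      by_cases h0 : f p i = 0
      · refine ⟨ε / 4, by positivity, ?_⟩
        rw [h0, sub_zero, abs_of_pos (by positivity)]
      · refine ⟨f p i, h0, ?_⟩
        rw [sub_self, abs_zero]
        positivity
    refine ⟨v, hv0, fun x hx => ?_⟩
    have h5 : |f p i - f x i| ≤ ε / 4 :=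
      (dist_le_pi_dist (f p) (f x) i).trans (hf (h3 i j p hp x hx)).le
    have := abs_sub_le v (f p i) (f x i)
    linarith
  choose v hv0 hv using hv
  choose F hF1 hF2 using fun i => exists_glue_real (h1 i) (h2 i)
    (fun j => ContinuousMap.const K (v i j)) ⟨fun x => f x i, by fun_prop⟩ (half_pos hε).le (hv i)
  refine ⟨⟨fun x i => F i x, by fun_prop⟩, ?_, fun i j x hx => ?_⟩
  · refine lt_of_le_of_lt ((ContinuousMap.dist_le (half_pos hε).le).2 fun x => ?_) (half_lt_self hε)
    exact (dist_pi_le_iff (half_pos hε).le).2 fun i => hF2 i x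
  · have e : F i x = v i j := hF1 i j x hx
    intro h0
    exact hv0 i j (e.symm.trans h0)

lemma HasColorCovers.avoids {n : ℕ} {A : Set K} (hA : IsClosed A) (h : HasColorCovers n A) :
    Avoids n A := by
  rw [Avoids, Metric.dense_iff]
  intro f ε hε
  obtain ⟨δ, hδ, hf⟩ := exists_ne_zero_on_colors f hε
  obtain ⟨N, D, h1, h2, h3, h4⟩ := h.exists_closed hA hδ
  obtain ⟨f', hd, hf'⟩ := hf N D h1 h2 h3
  refine ⟨f', hd, fun x hx h0 => ?_⟩
  obtain ⟨i, hi⟩ := mem_iUnion.1 (h4 hx)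
  obtain ⟨j, hj⟩ := mem_iUnion.1 hi
  exact hf' i j x hj (congrFun h0 i)

lemma indBelow.avoids {n : ℕ} {A : Set K} (hA : IsCompact A) (h : indBelow n ↥A) :
    Avoids n A := by
  induction n generalizing A with
  | zero =>
    have : IsEmpty ↥A := h
    rw [isEmpty_coe_sort] at this
    subst this
    exact Dense.mono (fun g _ x hx => absurd hx (notMem_empty x)) dense_univ
  | succ n ih =>
    refine HasColorCovers.avoids hA.isClosed (HasColorCovers.of_finite fun ε hε => ?_)
    have : CompactSpace ↥A := isCompact_iff_compactSpace.1 hA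
    rw [indBelow_succ_iff] at h
    choose V hVo hxV hVb hVf using fun x : ↥A =>
      h x (ball x (ε / 2)) isOpen_ball (mem_ball_self (half_pos hε))
    obtain ⟨t, ht⟩ := isCompact_univ.elim_finite_subcover V hVo
      fun x _ => mem_iUnion.2 ⟨x, hxV x⟩
    obtain ⟨m, ⟨e⟩⟩ := Finite.exists_equiv_fin ↥t
    set p : Fin m → ↥A := fun k => (e.symm k : ↥A) with hp
    have hcov : ∀ x : ↥A, ∃ k, x ∈ V (p k) := by
      intro x
      obtain ⟨y, hy, hxy⟩ := mem_iUnion₂.1 (ht (mem_univ x))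
      exact ⟨e ⟨y, hy⟩, by simpa [hp] using hxy⟩
    have hFr : ∀ x : ↥A, Avoids n (Subtype.val '' frontier (V x)) := by
      intro x
      refine ih (isClosed_frontier.isCompact.image continuous_subtype_val) ?_
      have hm : ∀ y : ↥(Subtype.val '' frontier (V x)), (y : K) ∈ A := by
        rintro ⟨_, z, hz, rfl⟩
        exact z.2
      refine (hVf x).of_isInducing (e := fun y => ⟨⟨y, hm y⟩, by
        obtain ⟨_, z, hz, rfl⟩ := y
        exact hz⟩) ?_
      have h1 : IsInducing (fun y : ↥(Subtype.val '' frontier (V x)) => (y : K)) :=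
        IsInducing.subtypeVal
      exact (IsInducing.of_comp_iff IsInducing.subtypeVal).1
        ((IsInducing.of_comp_iff IsInducing.subtypeVal).1 h1)
    have hB : Avoids n (⋃ k, Subtype.val '' frontier (V (p k))) :=
      Avoids.iUnion (fun k => isClosed_frontier.isCompact.image continuous_subtype_val)
        fun k => hFr _
    obtain ⟨N, C, hC1, hC2, hC3, hC4⟩ := hB.hasColorCovers (isCompact_iUnion fun k =>
      isClosed_frontier.isCompact.image continuous_subtype_val) ε hε
    set U : Set K := ⋃ i, ⋃ j, C i j with hU
    have hUo : IsOpen U := isOpen_iUnion fun i => isOpen_iUnion fun j => hC1 i j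
    set P : Fin m → Set K := fun k =>
      (Subtype.val '' (closure (V (p k)) \ ⋃ l : Fin m, ⋃ _ : l < k, V (p l))) \ U with hP
    have hPc : ∀ k, IsClosed (P k) := by
      intro k
      refine IsCompact.isClosed (IsCompact.diff ?_ hUo)
      refine IsCompact.image (IsClosed.isCompact ?_) continuous_subtype_val
      exact isClosed_closure.sdiff (isOpen_iUnion fun l => isOpen_iUnion fun _ => hVo _)
    have hPV : ∀ k (x : ↥A), (x : K) ∈ P k → x ∈ V (p k) ∧ ∀ l < k, x ∉ V (p l) := by
      rintro k x ⟨⟨z, hz, hzx⟩, hxU⟩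
      obtain rfl : z = x := Subtype.ext hzx
      refine ⟨?_, fun l hl hzl => hz.2 (mem_iUnion₂.2 ⟨l, hl, hzl⟩)⟩
      by_contra hzV
      refine hxU (hC4 (mem_iUnion.2 ⟨k, mem_image_of_mem _ ?_⟩))
      rw [(hVo _).frontier_eq]
      exact ⟨hz.1, hzV⟩
    have hPA : ∀ k, P k ⊆ A := by
      rintro k _ ⟨⟨z, hz, rfl⟩, -⟩
      exact z.2
    have hPd : ∀ k l, k ≠ l → ∀ x ∈ P k, x ∉ P l := by
      intro k l hkl x hx hx'
      have h1 := hPV k ⟨x, hPA k hx⟩ hx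
      have h2 := hPV l ⟨x, hPA k hx⟩ hx'
      rcases lt_or_gt_of_ne hkl with hlt | hlt
      · exact h2.2 k hlt h1.1
      · exact h1.2 l hlt h2.1
    have hAP : ∀ x ∈ A, x ∉ U → ∃ k, x ∈ P k := by
      intro x hx hxU
      classical
      have hex : ∃ k : ℕ, ∃ hk : k < m, (⟨x, hx⟩ : ↥A) ∈ V (p ⟨k, hk⟩) := by
        obtain ⟨k, hk⟩ := hcov ⟨x, hx⟩
        exact ⟨k, k.2, hk⟩
      obtain ⟨hk, hk'⟩ := Nat.find_spec hex
      refine ⟨⟨Nat.find hex, hk⟩, ⟨⟨⟨x, hx⟩, ⟨subset_closure hk', fun hcon => ?_⟩, rfl⟩, hxU⟩⟩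
      obtain ⟨l, hl, hl'⟩ := mem_iUnion₂.1 hcon
      exact Nat.find_min hex hl ⟨l.2, hl'⟩
    set W : Fin m → Set K := fun k => ball (p k : K) (ε / 2) ∩
      ⋂ l : Fin m, ⋂ _ : l ≠ k, {x | infEDist x (P k) < infEDist x (P l)} with hW
    refine ⟨Fin N ⊕ Fin m, inferInstance,
      Fin.lastCases (Sum.elim (fun _ => ∅) W) (fun i => Sum.elim (C i) fun _ => ∅), ?_, ?_, ?_, ?_⟩
    · intro i j
      induction i using Fin.lastCases with
      | last =>
        cases j with
        | inl j => simp
        | inr k =>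
          simp only [Fin.lastCases_last, Sum.elim_inr]
          refine isOpen_ball.inter (isOpen_iInter_of_finite fun l =>
            isOpen_iInter_of_finite fun _ => isOpen_lt ?_ ?_)
          · exact continuous_infEDist
          · exact continuous_infEDist
      | cast i =>
        cases j with
        | inl j => simpa using hC1 i j
        | inr k => simp
    · intro i j k hjk
      induction i using Fin.lastCases with
      | last =>
        rcases j with j | j <;> rcases k with k | k <;> simp
        refine Set.disjoint_left.2 fun x hx hx' => ?_
        have hne : j ≠ k := fun hh => hjk (by rw [hh])
        have h1 : infEDist x (P j) < infEDist x (P k) := mem_iInter₂.1 hx.2 k hne.symm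
        have h2 : infEDist x (P k) < infEDist x (P j) := mem_iInter₂.1 hx'.2 j hne
        exact lt_asymm h1 h2
      | cast i =>
        rcases j with j | j <;> rcases k with k | k <;> simp
        exact hC2 i fun hh => hjk (by rw [hh])
    · intro i j x hx y hy
      induction i using Fin.lastCases with
      | last =>
        rcases j with j | j
        · simp at hx
        · simp only [Fin.lastCases_last, Sum.elim_inr] at hx hy
          have h1 := mem_ball.1 hx.1
          have h2 := mem_ball.1 hy.1
          linarith [dist_triangle_right x y (p j : K)]
      | cast i =>
        rcases j with j | j
        · simp only [Fin.lastCases_castSucc, Sum.elim_inl] at hx hy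
          exact hC3 i j x hx y hy
        · simp at hx
    · intro x hx
      by_cases hxU : x ∈ U
      · obtain ⟨i, hi⟩ := mem_iUnion.1 hxU
        obtain ⟨j, hj⟩ := mem_iUnion.1 hi
        exact mem_iUnion.2 ⟨i.castSucc, mem_iUnion.2 ⟨Sum.inl j, by simpa using hj⟩⟩
      · obtain ⟨k, hk⟩ := hAP x hx hxU
        refine mem_iUnion.2 ⟨Fin.last n, mem_iUnion.2 ⟨Sum.inr k, ?_⟩⟩
        simp only [Fin.lastCases_last, Sum.elim_inr]
        refine ⟨?_, mem_iInter₂.2 fun l hl => ?_⟩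
        · exact hVb (p k) (hPV k ⟨x, hx⟩ hk).1
        · change infEDist x (P k) < infEDist x (P l)
          rw [infEDist_zero_of_mem hk]
          refine pos_iff_ne_zero.2 fun h0 => hPd k l hl.symm x hk ?_
          exact (mem_iff_infEDist_zero_of_closed (hPc l)).2 h0

end DimensionAvoids

section Decomposition

lemma indBelow_of_denseRange {K : Type u} [MetricSpace K] [CompactSpace K] {N : ℕ}
    {g : ℕ → C(K, Fin N → ℝ)} (hg : DenseRange g) {m : ℕ} {X : Type u} [TopologicalSpace X]
    {e : X → K} (he : IsInducing e) {I : Finset (Fin N)} (hI : I.card = m)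
    (h : ∀ x, ∃ i ∈ I, ∀ k, g k (e x) i ≠ 0) : indBelow m X := by
  induction m generalizing X I with
  | zero =>
    refine indBelow_zero_iff.2 ⟨fun x => ?_⟩
    obtain ⟨i, hi, -⟩ := h x
    simp [Finset.card_eq_zero.1 hI] at hi
  | succ m ih =>
    rw [indBelow_succ_iff]
    intro x U hU hx
    obtain ⟨U', hU', rfl⟩ := he.isOpen_iff.1 hU
    obtain ⟨ρ, hρ, hb⟩ := Metric.isOpen_iff.1 hU' (e x) hx
    obtain ⟨i, hi⟩ : I.Nonempty := Finset.card_pos.1 (by omega)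
    set φ : C(K, Fin N → ℝ) := ⟨fun y _ => ρ / 2 - dist y (e x), by fun_prop⟩ with hφ
    obtain ⟨k, hk⟩ := hg.exists_dist_lt φ (half_pos hρ)
    have hk' : ∀ y, |(ρ / 2 - dist y (e x)) - g k y i| < ρ / 2 := fun y =>
      ((dist_le_pi_dist (φ y) (g k y) i).trans (ContinuousMap.dist_apply_le_dist y)).trans_lt hk
    have hc : Continuous fun z => g k (e z) i :=
      (continuous_apply i).comp ((g k).continuous.comp he.continuous)
    refine ⟨{z | 0 < g k (e z) i}, isOpen_lt continuous_const hc, ?_, fun z hz => hb ?_, ?_⟩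
    · have := (abs_lt.1 (hk' (e x))).2
      rw [dist_self] at this
      change 0 < g k (e x) i
      linarith
    · have := (abs_lt.1 (hk' (e z))).1
      have hz' : 0 < g k (e z) i := hz
      rw [mem_ball]
      linarith
    · refine ih (e := fun z => e z) (he.comp IsInducing.subtypeVal)
        (I := I.erase i) (by rw [Finset.card_erase_of_mem hi]; omega) fun z => ?_
      have hz : g k (e z) i = 0 := (frontier_lt_subset_eq continuous_const hc z.2).symm
      obtain ⟨j, hj, hjk⟩ := h z
      refine ⟨j, Finset.mem_erase.2 ⟨fun hji => ?_, hj⟩, hjk⟩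
      subst hji
      exact hjk k hz

variable {K : Type u} [MetricSpace K] [CompactSpace K]

lemma Avoids.eventually_sequence {N : ℕ} {A : Set K} (hA : IsCompact A) (h : Avoids N A) (M : ℕ) :
    ∀ᶠ g in residual (ℕ → C(K, Fin N → ℝ)), ∀ x ∈ A, ∃ i, ∀ k < M, g k x i ≠ 0 := by
  refine residual_of_dense_open ?_ fun g => ?_
  · rw [isOpen_iff_eventually]
    intro g hg
    refine hA.eventually_forall_of_forall_eventually fun x hx => ?_
    obtain ⟨i, hi⟩ := hg x hx
    have h1 : ∀ᶠ q : (ℕ → C(K, Fin N → ℝ)) × K in 𝓝 (g, x), ∀ k ∈ Finset.range M,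
        q.1 k q.2 i ≠ 0 := by
      refine (Filter.eventually_all_finset _).2 fun k hk => ?_
      have hc : Continuous fun q : (ℕ → C(K, Fin N → ℝ)) × K => q.1 k q.2 i := by
        fun_prop
      exact hc.continuousAt.eventually_ne (hi k (Finset.mem_range.1 hk))
    filter_upwards [h1] with q hq
    exact ⟨i, fun k hk => hq k (Finset.mem_range.2 hk)⟩
  · have hstep : ∀ m : ℕ, ∃ g' : ℕ → C(K, Fin N → ℝ), (∀ k, dist (g' k) (g k) < 1 / ((m : ℝ) + 1)) ∧
        ∀ x ∈ A, ∃ i, ∀ k < M, g' k x i ≠ 0 := by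
      intro m
      have hm : (0 : ℝ) < 1 / ((m : ℝ) + 1) := by positivity
      choose δ hδ hf using fun k => exists_ne_zero_on_colors (g k) hm
      obtain ⟨δ', hδ', hle⟩ : ∃ δ' > 0, ∀ k < M, δ' ≤ δ k := by
        clear hf
        induction M with
        | zero => exact ⟨1, one_pos, fun k hk => absurd hk (Nat.not_lt_zero k)⟩
        | succ M ih =>
          obtain ⟨δ', h1, h2⟩ := ih
          refine ⟨min δ' (δ M), lt_min h1 (hδ M), fun k hk => ?_⟩
          rcases Nat.lt_succ_iff_lt_or_eq.1 hk with hk | rfl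
          · exact (min_le_left _ _).trans (h2 k hk)
          · exact min_le_right _ _
      obtain ⟨J, D, h1, h2, h3, h4⟩ := (h.hasColorCovers hA).exists_closed hA.isClosed hδ'
      have hex : ∀ k, ∃ f' : C(K, Fin N → ℝ), dist f' (g k) < 1 / ((m : ℝ) + 1) ∧
          (k < M → ∀ i j, ∀ x ∈ D i j, f' x i ≠ 0) := by
        intro k
        by_cases hk : k < M
        · obtain ⟨f', h5, h6⟩ := hf k J D h1 h2
            fun i j x hx y hy => (h3 i j x hx y hy).trans_le (hle k hk)
          exact ⟨f', h5, fun _ => h6⟩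
        · exact ⟨g k, by rwa [dist_self], fun hk' => absurd hk' hk⟩
      choose g' hg1 hg2 using hex
      refine ⟨g', hg1, fun x hx => ?_⟩
      obtain ⟨i, hi⟩ := mem_iUnion.1 (h4 hx)
      obtain ⟨j, hj⟩ := mem_iUnion.1 hi
      exact ⟨i, fun k hk => hg2 k hk i j x hj⟩
    choose G hG1 hG2 using hstep
    refine mem_closure_of_tendsto (f := G) (b := atTop) ?_ (Eventually.of_forall hG2)
    rw [tendsto_pi_nhds]
    intro k
    rw [tendsto_iff_dist_tendsto_zero]
    exact squeeze_zero (fun _ => dist_nonneg) (fun m => (hG1 m k).le)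
      tendsto_one_div_add_atTop_nhds_zero_nat

lemma eventually_denseRange {E : Type*} [TopologicalSpace E] [SecondCountableTopology E] :
    ∀ᶠ g in residual (ℕ → E), DenseRange g := by
  have h1 : ∀ᶠ g in residual (ℕ → E), ∀ U ∈ countableBasis E, U.Nonempty → ∃ k, g k ∈ U := by
    refine (eventually_countable_ball (countable_countableBasis E)).2 fun U hU => ?_
    have hUo := isOpen_of_mem_countableBasis hU
    rcases U.eq_empty_or_nonempty with rfl | ⟨u, hu⟩
    · exact Eventually.of_forall fun g h => absurd h not_nonempty_empty
    refine Filter.mem_of_superset (residual_of_dense_open (s := {g : ℕ → E | ∃ k, g k ∈ U}) ?_ ?_)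
      fun g hg _ => hg
    · rw [ofPred_exists]
      exact isOpen_iUnion fun k => hUo.preimage (continuous_apply k)
    · intro g
      refine mem_closure_of_tendsto (f := fun m => Function.update g m u) (b := atTop) ?_
        (Eventually.of_forall fun m => ⟨m, by simpa using hu⟩)
      rw [tendsto_pi_nhds]
      intro k
      refine tendsto_const_nhds.congr' ?_
      filter_upwards [eventually_gt_atTop k] with m hm
      rw [Function.update_of_ne hm.ne]
  filter_upwards [h1] with g hg
  rw [DenseRange, (isBasis_countableBasis E).dense_iff]
  intro U hU hne
  obtain ⟨k, hk⟩ := hg U hU hne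
  exact ⟨g k, hk, mem_range_self k⟩

/-- A `σ`-compact set of dimension less than `n + s` splits into an `F_σ` part of
dimension less than `n` and a remainder of dimension less than `s`. -/
lemma exists_indBelow_split {n s : ℕ} {C : ℕ → Set K} (hC : ∀ k, IsCompact (C k))
    (h : ∀ k, Avoids (n + s) (C k)) :
    ∃ Z : ℕ → Set K, (∀ k, IsClosed (Z k)) ∧ indBelow n ↥((⋃ k, C k) ∩ ⋃ k, Z k) ∧
      indBelow s ↥((⋃ k, C k) \ ⋃ k, Z k) := by
  have h1 : ∀ᶠ g in residual (ℕ → C(K, Fin (n + s) → ℝ)), ∀ p M, ∀ x ∈ C p,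
      ∃ i, ∀ k < M, g k x i ≠ 0 :=
    eventually_countable_forall.2 fun p => eventually_countable_forall.2 fun M =>
      (h p).eventually_sequence (hC p) M
  obtain ⟨g, hg1, hgd⟩ := (dense_of_mem_residual (h1.and eventually_denseRange)).nonempty
  have hg : ∀ x ∈ ⋃ k, C k, ∃ i, ∀ k, g k x i ≠ 0 := by
    intro x hx
    obtain ⟨p, hp⟩ := mem_iUnion.1 hx
    by_contra! hcon
    choose κ hκ using hcon
    obtain ⟨i, hi⟩ := hg1 p (Finset.univ.sup κ + 1) x hp
    exact hi (κ i) (Nat.lt_succ_of_le (Finset.le_sup (Finset.mem_univ i))) (hκ i)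
  obtain ⟨q, hq⟩ := exists_surjective_nat (Fin s → ℕ)
  refine ⟨fun k => {x | ∀ a, g (q k a) x (Fin.natAdd n a) = 0}, fun k => ?_, ?_, ?_⟩
  · simp only [ofPred_forall]
    exact isClosed_iInter fun a => isClosed_eq (by fun_prop) continuous_const
  · refine indBelow_of_denseRange hgd IsInducing.subtypeVal
      (I := Finset.univ.map (Fin.castAddEmb s)) (by simp) fun x => ?_
    obtain ⟨i, hi⟩ := hg x x.2.1
    obtain ⟨k, hk⟩ := mem_iUnion.1 x.2.2
    induction i using Fin.addCases with
    | left a => exact ⟨_, by simp, hi⟩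
    | right a => exact absurd (hk a) (hi _)
  · refine indBelow_of_denseRange hgd IsInducing.subtypeVal
      (I := Finset.univ.map (Fin.natAddEmb n)) (by simp) fun x => ?_
    by_contra! hcon
    have hcon' : ∀ a, ∃ k, g k x (Fin.natAdd n a) = 0 := fun a => hcon _ (by simp)
    choose κ hκ using hcon'
    obtain ⟨k, hk⟩ := hq κ
    refine x.2.2 (mem_iUnion.2 ⟨k, fun a => ?_⟩)
    rw [hk]
    exact hκ a

lemma indBelow_iUnion {n : ℕ} {C : ℕ → Set K} (hC : ∀ k, IsCompact (C k))
    (h : ∀ k, Avoids n (C k)) : indBelow n ↥(⋃ k, C k) := by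
  obtain ⟨Z, -, h1, h2⟩ := exists_indBelow_split (s := 0) hC h
  rw [indBelow_zero_iff, isEmpty_coe_sort, sdiff_eq_empty] at h2
  rwa [inter_eq_left.2 h2] at h1

end Decomposition

section FiniteFibers

lemma exists_separated {K : Type*} [MetricSpace K] {T : Set K} (hT : T.Infinite) (m : ℕ) :
    ∃ x : Fin m → K, (∀ a, x a ∈ T) ∧
      ∃ p : ℕ, ∀ a b, a ≠ b → 1 / ((p : ℝ) + 1) ≤ dist (x a) (x b) := by
  have := hT.to_subtype
  set x : Fin m → K := fun a => (Infinite.natEmbedding ↥T (a : ℕ) : K) with hx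
  have hinj : Function.Injective x := fun a b hab =>
    Fin.ext ((Infinite.natEmbedding ↥T).injective (Subtype.ext hab))
  refine ⟨x, fun a => (Infinite.natEmbedding ↥T (a : ℕ)).2, ?_⟩
  have h1 : ∀ᶠ p : ℕ in atTop, ∀ a b, a ≠ b → 1 / ((p : ℝ) + 1) ≤ dist (x a) (x b) := by
    refine eventually_all.2 fun a => eventually_all.2 fun b => ?_
    by_cases hab : a = b
    · exact Eventually.of_forall fun p h => absurd hab h
    filter_upwards [tendsto_one_div_add_atTop_nhds_zero_nat.eventually_le_const
      (dist_pos.2 (hinj.ne hab))] with p hp _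
    exact hp
  exact h1.exists

lemma eventually_lt_const_nhdsGT {b : ℝ} (hb : 0 < b) (c : ℝ) :
    ∀ᶠ η in 𝓝[>] (0 : ℝ), c * η < b := by
  have : Tendsto (fun η : ℝ => c * η) (𝓝[>] 0) (𝓝 (c * 0)) :=
    (tendsto_id.const_mul c).mono_left nhdsWithin_le_nhds
  rw [mul_zero] at this
  exact this.eventually_lt_const hb

variable {K : Type*} [MetricSpace K] [CompactSpace K]

lemma Avoids.eventually_close_of_fiber {n : ℕ} {A : Set K} (hA : IsCompact A) (h : Avoids n A)
    {τ : ℝ} (hτ : 0 < τ) :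
    ∀ᶠ f in residual C(K, Fin n → ℝ), ∀ x : Fin (n + 1) → K, (∀ a, x a ∈ A) →
      (∀ a, f (x a) = f (x 0)) → ∃ a b, a ≠ b ∧ dist (x a) (x b) < τ := by
  refine eventually_residual_of_dense_balls fun f ε hε => ?_
  obtain ⟨δ, hδ, hf⟩ := Metric.uniformContinuous_iff.1
    (CompactSpace.uniformContinuous_of_continuous f.continuous) (ε / 4) (by positivity)
  obtain ⟨N, D, h1, h2, h3, h4⟩ := (h.hasColorCovers hA).exists_closed hA.isClosed (lt_min hδ hτ)
  have hv : ∀ i j, ∃ v : ℝ, ∀ x ∈ D i j, |v - f x i| ≤ ε / 4 := by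
    intro i j
    rcases (D i j).eq_empty_or_nonempty with he | ⟨p, hp⟩
    · exact ⟨0, by simp [he]⟩
    · exact ⟨f p i, fun x hx => (dist_le_pi_dist (f p) (f x) i).trans
        (hf ((h3 i j p hp x hx).trans_le (min_le_left _ _))).le⟩
  choose v hv using hv
  have ht : ∀ᶠ t in 𝓝[>] (0 : ℝ), 0 < t ∧ (N : ℝ) * t < ε / 4 ∧ ∀ i j k, j ≠ k →
      (v i j + t * ((j : ℕ) : ℝ)) - (v i k + t * ((k : ℕ) : ℝ)) ≠ 0 :=
    (eventually_mem_nhdsWithin.mono fun t ht => ht).and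
      ((eventually_lt_const_nhdsGT (by positivity) _).and
        (eventually_all.2 fun i => eventually_sub_ne (v i) 0))
  obtain ⟨t, ht0, htN, htv⟩ := ht.exists
  have hη : ∀ᶠ η in 𝓝[>] (0 : ℝ), 0 < η ∧ ∀ i j k, j ≠ k →
      2 * η < |(v i j + t * ((j : ℕ) : ℝ)) - (v i k + t * ((k : ℕ) : ℝ))| := by
    refine (eventually_mem_nhdsWithin.mono fun t ht => ht).and (eventually_all.2 fun i =>
      eventually_all.2 fun j => eventually_all.2 fun k => ?_)
    by_cases hjk : j = k
    · exact Eventually.of_forall fun η h => absurd hjk h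
    · filter_upwards [eventually_lt_const_nhdsGT (abs_pos.2 (htv i j k hjk)) 2] with η hη _
      exact hη
  obtain ⟨η, hη0, hη⟩ := hη.exists
  choose F hF1 hF2 using fun i => exists_glue_real (h1 i) (h2 i)
    (fun j => ContinuousMap.const K (v i j + t * ((j : ℕ) : ℝ))) ⟨fun x => f x i, by fun_prop⟩
    (half_pos hε).le (by
      intro j x hx
      have e1 : |t * ((j : ℕ) : ℝ)| ≤ ε / 4 := by
        rw [abs_of_nonneg (by positivity)]
        have : ((j : ℕ) : ℝ) ≤ N := by exact_mod_cast j.2.le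
        nlinarith
      have e2 := abs_add_le (v i j - f x i) (t * ((j : ℕ) : ℝ))
      have e3 := hv i j x hx
      change |v i j + t * ((j : ℕ) : ℝ) - f x i| ≤ ε / 2
      rw [show v i j + t * ((j : ℕ) : ℝ) - f x i = v i j - f x i + t * ((j : ℕ) : ℝ) by ring]
      linarith)
  set f' : C(K, Fin n → ℝ) := ⟨fun x i => F i x, by fun_prop⟩ with hf'
  refine ⟨f', ?_, η, hη0, fun g hg x hxA hxg => ?_⟩
  · refine lt_of_le_of_lt ((ContinuousMap.dist_le (half_pos hε).le).2 fun x => ?_) (half_lt_self hε)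
    exact (dist_pi_le_iff (half_pos hε).le).2 fun i => hF2 i x
  · have hex : ∀ a, ∃ i j, x a ∈ D i j := fun a => by simpa using h4 (hxA a)
    choose i j hij using hex
    obtain ⟨a, b, hab, hi⟩ := Fintype.exists_ne_map_eq_of_card_lt i (by simp)
    refine ⟨a, b, hab, ?_⟩
    have hga : ∀ a, |g (x a) (i a) - (v (i a) (j a) + t * ((j a : ℕ) : ℝ))| < η := by
      intro a
      rw [← show f' (x a) (i a) = v (i a) (j a) + t * ((j a : ℕ) : ℝ) from
        hF1 (i a) (j a) (x a) (hij a)]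
      exact ((dist_le_pi_dist (g (x a)) (f' (x a)) (i a)).trans
        (ContinuousMap.dist_apply_le_dist _)).trans_lt hg
    have hj : j a = j b := by
      by_contra hne
      have e1 := hη (i a) (j a) (j b) hne
      have e2 := hga a
      have e3 := hga b
      rw [hxg] at e2 e3
      rw [← hi] at e3
      rw [abs_lt] at e2 e3
      refine absurd e1 (not_lt.2 (abs_le.2 ⟨?_, ?_⟩)) <;> linarith [e2.1, e2.2, e3.1, e3.2]
    refine (h3 (i a) (j a) _ (hij a) _ ?_).trans_le (min_le_right _ _)
    rw [hi, hj]
    exact hij b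

lemma eventually_finite_fibers {n : ℕ} {A : ℕ → Set K} (hA : ∀ m, IsCompact (A m))
    (hmono : Monotone A) (h : ∀ m, Avoids n (A m)) :
    ∀ᶠ f : C(K, Fin n → ℝ) in residual C(K, Fin n → ℝ), ∀ y, ((⋃ m, A m) ∩ ⇑f ⁻¹' {y}).Finite := by
  have h1 : ∀ᶠ f in residual C(K, Fin n → ℝ), ∀ m p : ℕ, ∀ x : Fin (n + 1) → K,
      (∀ a, x a ∈ A m) → (∀ a, f (x a) = f (x 0)) →
        ∃ a b, a ≠ b ∧ dist (x a) (x b) < 1 / ((p : ℝ) + 1) :=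
    eventually_countable_forall.2 fun m => eventually_countable_forall.2 fun p =>
      (h m).eventually_close_of_fiber (hA m) (by positivity)
  filter_upwards [h1] with f hf y
  by_contra hinf
  obtain ⟨x, hx, p, hp⟩ := exists_separated hinf (n + 1)
  choose m hm using fun a => mem_iUnion.1 (hx a).1
  obtain ⟨a, b, hab, hlt⟩ := hf (Finset.univ.sup m) p x
    (fun a => hmono (Finset.le_sup (Finset.mem_univ a)) (hm a))
    fun a => by rw [(hx a).2, (hx 0).2]
  exact absurd hlt (not_lt.2 (hp a b hab))

end FiniteFibers

section Dimensions

variable {K : Type*} [MetricSpace K]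

lemma IsPacking.mono {A B : Set K} (h : A ⊆ B) {δ : ℝ≥0} {s : Set (K × ℝ≥0)}
    (hs : IsPacking A δ s) : IsPacking B δ s :=
  ⟨hs.1, fun p hp => ⟨h (hs.2.1 p hp).1, (hs.2.1 p hp).2⟩, hs.2.2⟩

lemma packPre_mono (h : ℝ≥0 → ℝ≥0) {A B : Set K} (hAB : A ⊆ B) (δ : ℝ≥0) :
    packPre h A δ ≤ packPre h B δ :=
  iSup₂_le fun s hs => le_iSup₂_of_le s (hs.mono hAB) le_rfl

lemma packPre0_mono (h : ℝ≥0 → ℝ≥0) {A B : Set K} (hAB : A ⊆ B) :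
    packPre0 h A ≤ packPre0 h B :=
  iInf₂_mono fun δ _ => packPre_mono h hAB δ

lemma packMeasure_le_tsum (h : ℝ≥0 → ℝ≥0) {A : Set K} {c : ℕ → Set K} (hc : A ⊆ ⋃ i, c i) :
    packMeasure h A ≤ ∑' i, packPre0 h (c i) := by
  refine (iInf₂_le (fun i => A ∩ c i) ?_).trans
    (ENNReal.tsum_le_tsum fun i => packPre0_mono h inter_subset_right)
  rw [← inter_iUnion, inter_eq_left.2 hc]

lemma packMeasure_mono (h : ℝ≥0 → ℝ≥0) {A B : Set K} (hAB : A ⊆ B) :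
    packMeasure h A ≤ packMeasure h B :=
  le_iInf₂ fun _ hc => packMeasure_le_tsum h (hAB.trans hc.subset)

lemma packPre0_subsingleton {s : ℝ≥0} (hs : 0 < s) {A : Set K} (hA : A.Subsingleton) :
    packPre0 (fun r => r ^ (s : ℝ)) A = 0 := by
  have hle : ∀ δ : ℝ≥0, packPre (fun r => r ^ (s : ℝ)) A δ ≤ ((δ ^ (s : ℝ) : ℝ≥0) : ℝ≥0∞) := by
    refine fun δ => iSup₂_le fun p hp => ?_
    have hsub : p.Subsingleton := by
      intro a ha b hb
      by_contra hab
      have h1 := hp.2.2 ha hb hab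
      have h2 : a.1 = b.1 := hA (hp.2.1 a ha).1 (hp.2.1 b hb).1
      exact Set.disjoint_left.1 h1 (mem_closedBall_self a.2.2) (by
        rw [h2]
        exact mem_closedBall_self b.2.2)
    rcases p.eq_empty_or_nonempty with rfl | ⟨a, ha⟩
    · simp
    · obtain rfl := hsub.eq_singleton_of_mem ha
      rw [tsum_singleton (a : K × ℝ≥0) fun q : K × ℝ≥0 => ((q.2 ^ (s : ℝ) : ℝ≥0) : ℝ≥0∞)]
      exact ENNReal.coe_le_coe.2 (NNReal.rpow_le_rpow (hp.2.1 a ha).2 s.2)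
  refine le_antisymm (ENNReal.le_of_forall_pos_le_add fun ε hε _ => ?_) bot_le
  rw [zero_add]
  refine (iInf₂_le (ε ^ (1 / (s : ℝ))) (NNReal.rpow_pos hε)).trans ((hle _).trans ?_)
  rw [← NNReal.rpow_mul, one_div, inv_mul_cancel₀ (NNReal.coe_pos.2 hs).ne', NNReal.rpow_one]

lemma packMeasure_le_of_diff_finite {s : ℝ≥0} (hs : 0 < s) {A B S : Set K} (hS : S.Finite)
    (h : A \ S ⊆ B) :
    packMeasure (fun r => r ^ (s : ℝ)) A ≤ packMeasure (fun r => r ^ (s : ℝ)) B := by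
  refine le_iInf₂ fun c hc => ?_
  have := hS.to_subtype
  obtain ⟨e, he⟩ := exists_injective_nat ↥S
  set d : ℕ ⊕ ℕ → Set K := Sum.elim c fun k => {x | ∃ hx : x ∈ S, e ⟨x, hx⟩ = k} with hd
  have hAd : A ⊆ ⋃ i, d (Equiv.natSumNatEquivNat.symm i) := by
    intro x hx
    have : ∃ i, x ∈ d i := by
      by_cases hxS : x ∈ S
      · exact ⟨Sum.inr (e ⟨x, hxS⟩), hxS, rfl⟩
      · obtain ⟨i, hi⟩ := mem_iUnion.1 (hc.subset (h ⟨hx, hxS⟩))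
        exact ⟨Sum.inl i, hi⟩
    obtain ⟨i, hi⟩ := this
    exact mem_iUnion.2 ⟨Equiv.natSumNatEquivNat i, by rwa [Equiv.symm_apply_apply]⟩
  refine (packMeasure_le_tsum _ hAd).trans_eq ?_
  rw [Equiv.natSumNatEquivNat.symm.tsum_eq fun i => packPre0 (fun r => r ^ (s : ℝ)) (d i),
    ENNReal.summable.tsum_sum ENNReal.summable]
  have h0 : ∀ k, packPre0 (fun r => r ^ (s : ℝ)) (d (Sum.inr k)) = 0 := by
    refine fun k => packPre0_subsingleton hs ?_
    rintro x ⟨hx, hxk⟩ y ⟨hy, hyk⟩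
    exact congrArg Subtype.val (he (hxk.trans hyk.symm))
  simp only [h0, tsum_zero, add_zero]
  rfl

lemma pdim_mono {A B : Set K} (h : A ⊆ B) : pdim A ≤ pdim B := by
  by_cases hA : A = ∅
  · rw [pdim, if_pos hA, pdim]
    split_ifs
    · exact le_rfl
    · exact le_max_of_le_left (by norm_num)
  · have hB : B ≠ ∅ := fun hB => hA (subset_empty_iff.1 (hB ▸ h))
    rw [pdim, if_neg hA, pdim, if_neg hB]
    refine max_le_max le_rfl (iSup₂_le fun s hs => le_iSup₂_of_le s ?_ le_rfl)
    exact top_unique (hs.symm.trans_le (packMeasure_mono _ h))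

lemma hdim_mono {A B : Set K} (h : A ⊆ B) : hdim A ≤ hdim B := by
  by_cases hA : A = ∅
  · rw [hdim, if_pos hA, hdim]
    split_ifs
    · exact le_rfl
    · exact le_trans (by norm_num) (EReal.coe_ennreal_nonneg _)
  · have hB : B ≠ ∅ := fun hB => hA (subset_empty_iff.1 (hB ▸ h))
    rw [hdim, if_neg hA, hdim, if_neg hB]
    exact EReal.coe_ennreal_le_coe_ennreal_iff.2 (dimH_mono h)

lemma pdim_le_of_diff_finite {A B S : Set K} (hS : S.Finite) (h : A \ S ⊆ B) :
    pdim A ≤ max 0 (pdim B) := by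
  by_cases hA : A = ∅
  · rw [pdim, if_pos hA]
    exact le_max_of_le_left (by norm_num)
  rw [pdim, if_neg hA]
  refine max_le (le_max_left _ _) (iSup₂_le fun s hs => ?_)
  rcases eq_zero_or_pos s with rfl | hs0
  · simp
  have hB := top_unique (hs.symm.trans_le (packMeasure_le_of_diff_finite hs0 hS h))
  have hne : B ≠ ∅ := by
    rintro rfl
    have h0 := packMeasure_le_tsum (A := (∅ : Set K)) (fun r => r ^ (s : ℝ)) (c := fun _ => ∅)
      (empty_subset _)
    rw [hB] at h0
    simp [packPre0_subsingleton hs0 (subsingleton_empty (α := K))] at h0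
  rw [pdim, if_neg hne]
  exact le_max_of_le_right (le_max_of_le_right (le_iSup₂_of_le s hB le_rfl))

lemma hdim_le_of_diff_finite {A B S : Set K} (hS : S.Finite) (h : A \ S ⊆ B) :
    hdim A ≤ max 0 (hdim B) := by
  have h1 : dimH A ≤ dimH B := by
    refine (dimH_mono (show A ⊆ S ∪ B from fun x hx => ?_)).trans ?_
    · by_cases hxS : x ∈ S
      · exact Or.inl hxS
      · exact Or.inr (h ⟨hx, hxS⟩)
    · rw [dimH_union, dimH_finite hS]
      exact max_le bot_le le_rfl
  by_cases hA : A = ∅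
  · rw [hdim, if_pos hA]
    exact le_max_of_le_left (by norm_num)
  rw [hdim, if_neg hA]
  by_cases hB : B = ∅
  · rw [hB, dimH_empty, nonpos_iff_eq_zero] at h1
    simp [h1]
  · rw [hdim, if_neg hB]
    exact le_max_of_le_right (EReal.coe_ennreal_le_coe_ennreal_iff.2 h1)

lemma tdim_eq_top_or (A : Set K) : tdim A = ⊤ ∨ ∃ k : ℕ, indBelow k ↥A ∧ tdim A = (k : EReal) - 1 := by
  classical
  by_cases h : ∃ k, indBelow k ↥A
  · refine Or.inr ⟨Nat.find h, Nat.find_spec h, le_antisymm (Nat.find_spec h).indDim_le ?_⟩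
    refine le_sInf ?_
    rintro d ⟨k, hk, rfl⟩
    exact EReal.sub_le_sub (by exact_mod_cast Nat.find_min' h hk) le_rfl
  · refine Or.inl (top_unique (le_sInf ?_))
    rintro d ⟨k, hk, rfl⟩
    exact absurd ⟨k, hk⟩ h

end Dimensions

section TopologicalDimension

lemma indBelow_one_of_finite {X : Type*} [TopologicalSpace X] [T1Space X] [Finite X] :
    indBelow 1 X := by
  refine indBelow_succ_iff.2 fun x U hU hx => ⟨{x}, isOpen_discrete _, rfl, by simpa using hx, ?_⟩
  rw [indBelow_zero_iff, isEmpty_coe_sort]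
  exact (isClopen_discrete _).frontier_eq

variable {K : Type u} [MetricSpace K] [CompactSpace K]

lemma indBelow_of_diff_finite {m : ℕ} (hm : 1 ≤ m) {A B S : Set K} (hA : IsClosed A)
    (hS : S.Finite) (h : A \ S ⊆ B) (hB : indBelow m ↥B) : indBelow m ↥A := by
  have hSc : IsCompact (A ∩ S) := (hS.inter_of_right A).isCompact
  have hSa : Avoids m (A ∩ S) := by
    have : Finite ↥(A ∩ S) := (hS.inter_of_right A).to_subtype
    exact (indBelow_one_of_finite.mono hm).avoids hSc
  set C : ℕ → Set K := fun k => A ∩ {x | 1 / ((k : ℝ) + 1) ≤ infDist x S} with hC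
  have hCc : ∀ k, IsCompact (C k) := fun k =>
    (hA.inter (isClosed_le continuous_const (continuous_infDist_pt S))).isCompact
  by_cases hne : S.Nonempty
  swap
  · rw [not_nonempty_iff_eq_empty.1 hne, sdiff_empty] at h
    exact hB.subset h
  have hCB : ∀ k, C k ⊆ B := fun k x hx => h ⟨hx.1, fun hxS => by
    have h1 := hx.2
    have h2 : (0 : ℝ) < 1 / ((k : ℝ) + 1) := by positivity
    rw [mem_ofPred_eq, infDist_zero_of_mem hxS] at h1
    linarith⟩
  have h1 : indBelow m ↥(⋃ k, (C k ∪ (A ∩ S))) := by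
    refine indBelow_iUnion (fun k => (hCc k).union hSc) fun k => ?_
    rw [union_eq_iUnion]
    refine Avoids.iUnion ?_ ?_
    · rintro (_ | _)
      exacts [hSc, hCc k]
    · rintro (_ | _)
      exacts [hSa, (hB.subset (hCB k)).avoids (hCc k)]
  refine h1.subset fun x hx => ?_
  by_cases hxS : x ∈ S
  · exact mem_iUnion.2 ⟨0, Or.inr ⟨hx, hxS⟩⟩
  · have hpos := (hS.isClosed.notMem_iff_infDist_pos hne).1 hxS
    obtain ⟨k, hk⟩ := exists_nat_one_div_lt hpos
    exact mem_iUnion.2 ⟨k, Or.inl ⟨hx, hk.le⟩⟩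

lemma tdim_le_of_diff_finite {A B S : Set K} (hA : IsClosed A) (hS : S.Finite) (h : A \ S ⊆ B) :
    tdim A ≤ max 0 (tdim B) := by
  rcases tdim_eq_top_or B with hB | ⟨k, hk, hB⟩
  · rw [hB]
    exact le_max_of_le_right le_top
  rw [hB]
  refine (tdim_le_iff.2 (indBelow_of_diff_finite (le_max_left 1 k) hA hS h
    (hk.mono (le_max_right _ _)))).trans ?_
  rcases le_total 1 k with h1 | h1
  · rw [max_eq_right h1]
    exact le_max_right _ _
  · rw [max_eq_left h1, Nat.cast_one, EReal.sub_self (by decide) (by decide)]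
    exact le_max_left _ _

end TopologicalDimension

section CubeSystem

/-- The family of values `c j` together with the scales `r` and `η` is in general position:
the faces of the cubes of radius `r` around the `c j` are `10 η`-separated. -/
structure CubeSystem {n N : ℕ} (c : Fin N → Fin n → ℝ) (r η : ℝ) : Prop where
  pos : 0 < η
  le : 10 * η ≤ r
  gap : ∀ a j k, j ≠ k → 10 * η ≤ |c j a - c k a|
  gap_add : ∀ a j k, j ≠ k → 10 * η ≤ |c j a - c k a - 2 * r|

variable {n N : ℕ} {c : Fin N → Fin n → ℝ} {r η : ℝ}

lemma CubeSystem.gap_sub (h : CubeSystem c r η) {a : Fin n} {j k : Fin N} (hjk : j ≠ k) :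
    10 * η ≤ |c j a - c k a + 2 * r| := by
  have := h.gap_add a k j hjk.symm
  rwa [← abs_neg, show -(c j a - c k a + 2 * r) = c k a - c j a - 2 * r by ring]

lemma CubeSystem.eq_of_near_faces (h : CubeSystem c r η) {a : Fin n} {j k : Fin N} {z : ℝ}
    (hj : r - 8 * η < |z - c j a|) (hj' : |z - c j a| < r + 8 * η)
    (hk : r - 2 * η ≤ |z - c k a|) (hk' : |z - c k a| ≤ r + 2 * η) : j = k := by
  by_contra hne
  have h1 := h.gap a j k hne
  have h2 := h.gap_add a j k hne
  have h3 := h.gap_sub (a := a) hne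
  have h4 := h.pos
  have h5 := h.le
  rcases abs_cases (z - c j a) with ⟨e1, e2⟩ | ⟨e1, e2⟩ <;>
  rcases abs_cases (z - c k a) with ⟨e3, e4⟩ | ⟨e3, e4⟩ <;>
  rw [e1] at hj hj' <;> rw [e3] at hk hk'
  · exact absurd h1 (not_le.2 (abs_lt.2 ⟨by linarith, by linarith⟩))
  · exact absurd h3 (not_le.2 (abs_lt.2 ⟨by linarith, by linarith⟩))
  · exact absurd h2 (not_le.2 (abs_lt.2 ⟨by linarith, by linarith⟩))
  · exact absurd h1 (not_le.2 (abs_lt.2 ⟨by linarith, by linarith⟩))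

/-- Every point can be moved slightly so that it leaves each cube near whose faces it lies. -/
lemma CubeSystem.exists_shift (h : CubeSystem c r η) (y : Fin n → ℝ) :
    ∃ y' : Fin n → ℝ, dist y' y ≤ 4 * η ∧ ∀ j, dist y' (c j) ≤ r + η → dist y (c j) < r - η := by
  have hη := h.pos
  have hr := h.le
  have hex : ∀ a, ∃ z : ℝ, |z - y a| ≤ 4 * η ∧
      ∀ j, |z - c j a| ≤ r + η → |y a - c j a| < r - η := by
    intro a
    by_cases hk : ∃ k, r - 2 * η ≤ |y a - c k a| ∧ |y a - c k a| ≤ r + 2 * η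
    · obtain ⟨k, hk1, hk2⟩ := hk
      obtain ⟨z, hz1, hz2⟩ : ∃ z : ℝ, |z - y a| ≤ 4 * η ∧ r + 2 * η ≤ |z - c k a| := by
        rcases abs_cases (y a - c k a) with ⟨e1, e2⟩ | ⟨e1, e2⟩
        · refine ⟨y a + 4 * η, ?_, ?_⟩
          · rw [add_sub_cancel_left, abs_of_pos (by positivity)]
          · exact le_trans (by linarith) (le_abs_self _)
        · refine ⟨y a - 4 * η, ?_, ?_⟩
          · rw [show y a - 4 * η - y a = -(4 * η) by ring, abs_neg, abs_of_pos (by positivity)]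
          · exact le_trans (by linarith) (neg_le_abs _)
      refine ⟨z, hz1, fun j hj => ?_⟩
      have hjk : j ≠ k := by
        rintro rfl
        linarith
      by_contra hcon
      refine hjk (h.eq_of_near_faces (z := y a) (a := a) (by linarith) ?_ hk1 hk2)
      have := abs_sub_le (y a) z (c j a)
      rw [abs_sub_comm (y a) z] at this
      linarith
    · push Not at hk
      refine ⟨y a, by simpa using hη.le, fun j hj => ?_⟩
      by_contra hcon
      linarith [hk j (by linarith)]
  choose y' h1 h2 using hex
  refine ⟨y', (dist_pi_le_iff (by positivity)).2 h1, fun j hj => ?_⟩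
  rw [dist_pi_lt_iff (by linarith)]
  exact fun a => h2 a j ((dist_le_pi_dist y' (c j) a).trans hj)

lemma CubeSystem.exists_ne_of_near (h : CubeSystem c r η) {y : Fin n → ℝ}
    {J : Fin (n + 1) → Fin N} (h1 : ∀ a, ¬ dist y (c (J a)) < r - η)
    (h2 : ∀ a, dist y (c (J a)) ≤ r + η) : ∃ a b, a ≠ b ∧ J a = J b := by
  have hη := h.pos
  have hr := h.le
  have hex : ∀ a, ∃ i, r - η ≤ |y i - c (J a) i| ∧ |y i - c (J a) i| ≤ r + η := by
    intro a
    have := h1 a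
    rw [dist_pi_lt_iff (by linarith)] at this
    push Not at this
    obtain ⟨i, hi⟩ := this
    exact ⟨i, hi, (dist_le_pi_dist y (c (J a)) i).trans (h2 a)⟩
  choose i hi1 hi2 using hex
  obtain ⟨a, b, hab, hi⟩ := Fintype.exists_ne_map_eq_of_card_lt i (by simp)
  have e1 := hi1 a
  have e2 := hi2 a
  have e3 := hi1 b
  have e4 := hi2 b
  rw [← hi] at e3 e4
  exact ⟨a, b, hab, h.eq_of_near_faces (z := y (i a)) (a := i a) (by linarith) (by linarith)
    (by linarith) (by linarith)⟩

/-- Small generic translations of finitely many points are in general position. -/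
lemma exists_cubeSystem (b : Fin N → Fin n → ℝ) {r θ : ℝ} (hr : 0 < r) (hθ : 0 < θ) :
    ∃ c : Fin N → Fin n → ℝ, (∀ j, dist (c j) (b j) ≤ θ) ∧
      ∃ η, 10 * η < θ ∧ CubeSystem c r η := by
  have ht : ∀ᶠ t in 𝓝[>] (0 : ℝ), 0 < t ∧ (N : ℝ) * t < θ ∧
      (∀ a, ∀ j k, j ≠ k →
        (b j a + t * ((j : ℕ) : ℝ)) - (b k a + t * ((k : ℕ) : ℝ)) ≠ 0) ∧
      ∀ a, ∀ j k, j ≠ k →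
        (b j a + t * ((j : ℕ) : ℝ)) - (b k a + t * ((k : ℕ) : ℝ)) ≠ 2 * r :=
    (eventually_mem_nhdsWithin.mono fun t ht => ht).and
      ((eventually_lt_const_nhdsGT hθ _).and
        ((eventually_all.2 fun a => eventually_sub_ne (fun j => b j a) 0).and
          (eventually_all.2 fun a => eventually_sub_ne (fun j => b j a) (2 * r))))
  obtain ⟨t, ht0, htN, ht1, ht2⟩ := ht.exists
  set c : Fin N → Fin n → ℝ := fun j a => b j a + t * ((j : ℕ) : ℝ) with hc
  have hgap : ∀ v, (∀ a j k, j ≠ k → c j a - c k a ≠ v) →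
      ∀ᶠ η in 𝓝[>] (0 : ℝ), ∀ a j k, j ≠ k → 10 * η ≤ |c j a - c k a - v| := by
    intro v hv
    refine eventually_all.2 fun a => eventually_all.2 fun j => eventually_all.2 fun k => ?_
    by_cases hjk : j = k
    · exact Eventually.of_forall fun η h => absurd hjk h
    · filter_upwards [eventually_lt_const_nhdsGT
        (abs_pos.2 (sub_ne_zero.2 (hv a j k hjk))) 10] with η hη _
      exact hη.le
  have hη := ((eventually_mem_nhdsWithin (a := (0 : ℝ)) (s := Ioi 0)).and
    ((eventually_lt_const_nhdsGT hr 10).and ((eventually_lt_const_nhdsGT hθ 10).and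
      ((hgap 0 ht1).and (hgap (2 * r) ht2))))).exists
  obtain ⟨η, h1, h2, h3, h4, h5⟩ := hη
  refine ⟨c, fun j => (dist_pi_le_iff hθ.le).2 fun a => ?_, η, h3, h1, h2.le, ?_, h5⟩
  · rw [Real.dist_eq, hc]
    simp only [add_sub_cancel_left]
    rw [abs_of_nonneg (by positivity)]
    have : ((j : ℕ) : ℝ) ≤ N := by exact_mod_cast j.2.le
    nlinarith
  · simpa using h4

end CubeSystem

section Fill

variable {K : Type*} [MetricSpace K]

/-- The fibre of `g` over `y` in `W` stably has one of the properties `Λ i`. -/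
def StableFiber {n : ℕ} {ι : Type*} (Λ : ι → Set K → Prop) (W : Set K) (g : C(K, Fin n → ℝ))
    (y : Fin n → ℝ) : Prop :=
  ∃ i, ∀ᶠ y' in 𝓝 y, Λ i ({x | g x = y'} ∩ W)

lemma exists_disjoint_balls [CompactSpace K] {W : Set K} (hW : IsOpen W) {δ : ℝ} (hδ : 0 < δ) :
    ∃ (N : ℕ) (p : Fin N → K), (∀ j, p j ∈ W) ∧ (∀ x ∈ W, ∃ j, dist x (p j) < δ) ∧
      ∃ ρ > 0, ρ < δ ∧ (∀ j, closedBall (p j) ρ ⊆ W) ∧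
        Pairwise fun j k => Disjoint (closedBall (p j) ρ) (closedBall (p k) ρ) := by
  have hWt : TotallyBounded W := isCompact_univ.totallyBounded.subset (subset_univ W)
  obtain ⟨t, htW, htf, htc⟩ := Metric.finite_approx_of_totallyBounded hWt δ hδ
  obtain ⟨N, ⟨e⟩⟩ := Finite.exists_equiv_fin (h := htf.to_subtype)
  set p : Fin N → K := fun j => (e.symm j : K) with hp
  have hpinj : Function.Injective p := Subtype.val_injective.comp e.symm.injective
  have hpW : ∀ j, p j ∈ W := fun j => htW (e.symm j).2
  have hρ : ∀ᶠ ρ in 𝓝[>] (0 : ℝ), 0 < ρ ∧ ρ < δ ∧ (∀ j, closedBall (p j) ρ ⊆ W) ∧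
      ∀ j k, j ≠ k → 2 * ρ < dist (p j) (p k) := by
    refine (eventually_mem_nhdsWithin.mono fun t ht => ht).and
      (((eventually_lt_const_nhdsGT hδ 1).mono fun ρ hρ => by linarith).and
        ((eventually_all.2 fun j => ?_).and
          (eventually_all.2 fun j => eventually_all.2 fun k => ?_)))
    · obtain ⟨s, hs, hsW⟩ := Metric.isOpen_iff.1 hW (p j) (hpW j)
      filter_upwards [eventually_lt_const_nhdsGT hs 1] with ρ hρ
      exact (closedBall_subset_ball (by linarith)).trans hsW
    · by_cases hjk : j = k
      · exact Eventually.of_forall fun ρ h => absurd hjk h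
      · filter_upwards [eventually_lt_const_nhdsGT (dist_pos.2 (hpinj.ne hjk)) 2] with ρ hρ _
        exact hρ
  obtain ⟨ρ, h1, h2, h3, h4⟩ := hρ.exists
  refine ⟨N, p, hpW, fun x hx => ?_, ρ, h1, h2, h3, fun j k hjk => ?_⟩
  · obtain ⟨y, hy, hxy⟩ := mem_iUnion₂.1 (htc hx)
    exact ⟨e ⟨y, hy⟩, by simpa [hp] using hxy⟩
  · refine Set.disjoint_left.2 fun x hx hx' => ?_
    have := dist_triangle_left (p j) (p k) x
    linarith [h4 j k hjk, mem_closedBall.1 hx, mem_closedBall.1 hx']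

/-- A map is altered by `r` in such a way that near each centre it covers a cube stably. -/
lemma exists_stable_cubes [CompactSpace K] {n N : ℕ} {ι : Type*} {Λ : ι → Set K → Prop}
    (hΛ : ∀ i A B, A ⊆ B → Λ i A → Λ i B) {W : Set K}
    (hyp : ∀ V, IsOpen V → V.Nonempty → V ⊆ W → ∃ i, ∃ ψ : C(K, Fin n → ℝ), ∃ η > 0,
      ∀ g : C(K, Fin n → ℝ), dist g ψ < η → Λ i ({x | g x = 0} ∩ V))
    {p : Fin N → K} {ρ : ℝ} (hρ : 0 < ρ) (hpW : ∀ j, closedBall (p j) ρ ⊆ W)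
    (hdisj : Pairwise fun j k => Disjoint (closedBall (p j) ρ) (closedBall (p k) ρ))
    (f₁ : C(K, Fin n → ℝ)) {c : Fin N → Fin n → ℝ}
    (hf₁ : ∀ j, ∀ x ∈ closedBall (p j) ρ, f₁ x = c j) {r η : ℝ} (hη : 0 < η) (hr : η < r) :
    ∃ f : C(K, Fin n → ℝ), (∀ x, dist (f x) (f₁ x) ≤ r) ∧
      (∀ x, (∀ j, x ∉ ball (p j) ρ) → f x = f₁ x) ∧
      ∀ g : C(K, Fin n → ℝ), dist g f < η → ∀ j y, dist y (c j) < r - η →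
        StableFiber Λ W g y := by
  have hr0 : 0 < r := hη.trans hr
  have hb : ∀ j, ball (p j) (ρ / 2) ⊆ W := fun j =>
    (ball_subset_closedBall.trans (closedBall_subset_closedBall (by linarith))).trans (hpW j)
  choose i ψ θ hθ hψ using fun j => hyp (ball (p j) (ρ / 2)) isOpen_ball
    (nonempty_ball.2 (by positivity)) (hb j)
  set u : Fin N → C(K, Fin n → ℝ) := fun j =>
    ⟨fun x a => c j a + r * max (-1) (min 1 (ψ j x a / θ j)), by fun_prop⟩ with hu
  have huc : ∀ j x, dist (u j x) (c j) ≤ r := by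
    intro j x
    refine (dist_pi_le_iff hr0.le).2 fun a => ?_
    rw [Real.dist_eq]
    simp only [hu, ContinuousMap.coe_mk, add_sub_cancel_left]
    rw [abs_mul, abs_of_pos hr0]
    have : |max (-1) (min 1 (ψ j x a / θ j))| ≤ 1 :=
      abs_le.2 ⟨le_max_left _ _, max_le (by norm_num) (min_le_left _ _)⟩
    nlinarith
  have hsm : ∀ j, closedBall (p j) (ρ / 2) ⊆ ball (p j) ρ := fun j =>
    closedBall_subset_ball (by linarith)
  obtain ⟨f, hf1, hf2⟩ := exists_glue_pi (ι := Option (Fin N))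
    (D := fun o => o.elim (⋃ j, ball (p j) ρ)ᶜ fun j => closedBall (p j) (ρ / 2))
    (by
      rintro (_ | j)
      · exact (isOpen_iUnion fun j => isOpen_ball).isClosed_compl
      · exact isClosed_closedBall)
    (by
      rintro (_ | j) (_ | k) hjk
      · exact absurd rfl hjk
      · exact Set.disjoint_left.2 fun x hx hx' => hx (mem_iUnion.2 ⟨k, hsm k hx'⟩)
      · exact Set.disjoint_left.2 fun x hx hx' => hx' (mem_iUnion.2 ⟨j, hsm j hx⟩)
      · exact (hdisj fun h => hjk (by rw [h])).mono
          (closedBall_subset_closedBall (by linarith)) (closedBall_subset_closedBall (by linarith)))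
    (fun o => o.elim f₁ u) f₁ hr0.le
    (by
      rintro (_ | j) x hx
      · simpa using hr0.le
      · rw [hf₁ j x (closedBall_subset_closedBall (by linarith) hx)]
        exact huc j x)
  refine ⟨f, hf2, fun x hx => hf1 none x ?_, fun g hg j y hy => ⟨i j, ?_⟩⟩
  · simpa using hx
  · have ho : IsOpen {y' | dist y' (c j) < r - η} := isOpen_lt (by fun_prop) continuous_const
    filter_upwards [ho.mem_nhds hy] with y' hy'
    set h : C(K, Fin n → ℝ) := ⟨fun x a => ψ j x a + θ j * ((g x a - f x a - (y' a - c j a)) / r),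
      by fun_prop⟩ with hh
    have hbound : ∀ x a, |(g x a - f x a - (y' a - c j a)) / r| ≤
        (dist g f + dist y' (c j)) / r := by
      intro x a
      rw [abs_div, abs_of_pos hr0]
      refine div_le_div_of_nonneg_right ((abs_sub _ _).trans (add_le_add ?_ ?_)) hr0.le
      · exact (dist_le_pi_dist (g x) (f x) a).trans (ContinuousMap.dist_apply_le_dist x)
      · exact dist_le_pi_dist y' (c j) a
    have hlt : (dist g f + dist y' (c j)) / r < 1 := by
      rw [div_lt_one hr0]
      have : dist y' (c j) < r - η := hy'
      linarith
    have hhd : dist h (ψ j) < θ j := by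
      refine lt_of_le_of_lt ((ContinuousMap.dist_le (C := θ j * ((dist g f + dist y' (c j)) / r))
        (mul_nonneg (hθ j).le (by positivity))).2 fun x => ?_) ?_
      · refine (dist_pi_le_iff (mul_nonneg (hθ j).le (by positivity))).2 fun a => ?_
        rw [Real.dist_eq]
        simp only [hh, ContinuousMap.coe_mk, add_sub_cancel_left]
        rw [abs_mul, abs_of_pos (hθ j)]
        exact mul_le_mul_of_nonneg_left (hbound x a) (hθ j).le
      · exact mul_lt_of_lt_one_right (hθ j) hlt
    refine hΛ _ _ _ ?_ (hψ j h hhd)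
    rintro x ⟨hx0, hxb⟩
    refine ⟨?_, hb j hxb⟩
    ext a
    have e1 : ψ j x a + θ j * ((g x a - f x a - (y' a - c j a)) / r) = 0 := congrFun hx0 a
    have e2 : ψ j x a / θ j = -((g x a - f x a - (y' a - c j a)) / r) := by
      rw [div_eq_iff (hθ j).ne']
      linarith
    have e3 := abs_le.1 ((hbound x a).trans hlt.le)
    have e4 : f x a = c j a + r * max (-1) (min 1 (ψ j x a / θ j)) :=
      congrFun (hf1 (some j) x (ball_subset_closedBall hxb)) a
    rw [min_eq_right (by rw [e2]; linarith [e3.1]), max_eq_right (by rw [e2]; linarith [e3.2]),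
      e2] at e4
    have e5 : r * -((g x a - f x a - (y' a - c j a)) / r) = -(g x a - f x a - (y' a - c j a)) := by
      field_simp
    rw [e5] at e4
    linarith

lemma eventually_stableFiber_scale [CompactSpace K] {n : ℕ} {ι : Type*}
    {Λ : ι → Set K → Prop} (hΛ : ∀ i A B, A ⊆ B → Λ i A → Λ i B) {W : Set K} (hW : IsOpen W)
    (hyp : ∀ V, IsOpen V → V.Nonempty → V ⊆ W → ∃ i, ∃ ψ : C(K, Fin n → ℝ), ∃ η > 0,
      ∀ g : C(K, Fin n → ℝ), dist g ψ < η → Λ i ({x | g x = 0} ∩ V))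
    {τ : ℝ} (hτ : 0 < τ) :
    ∀ᶠ g : C(K, Fin n → ℝ) in residual C(K, Fin n → ℝ),
      (∀ y, closedBall y τ ⊆ g '' W → StableFiber Λ W g y) ∧
      (∀ x : Fin (n + 1) → K, (∀ a, x a ∈ W) → (∀ a, g (x a) = g (x 0)) →
        ¬ StableFiber Λ W g (g (x 0)) → ∃ a b, a ≠ b ∧ dist (x a) (x b) < τ) ∧
      ∀ x ∈ W, ∃ y, dist y (g x) < τ ∧ StableFiber Λ W g y := by
  refine eventually_residual_of_dense_balls fun f₀ ε hε => ?_
  set r : ℝ := min (ε / 4) (τ / 4) with hr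
  have hr0 : 0 < r := lt_min (by positivity) (by positivity)
  have hrε : r ≤ ε / 4 := min_le_left _ _
  have hrτ : r ≤ τ / 4 := min_le_right _ _
  obtain ⟨δ, hδ, hf₀⟩ := Metric.uniformContinuous_iff.1
    (CompactSpace.uniformContinuous_of_continuous f₀.continuous) (r / 8) (by positivity)
  obtain ⟨N, p, hpW, hcov, ρ, hρ, hρδ, hρW, hdisj⟩ :=
    exists_disjoint_balls hW (δ := min δ (τ / 2)) (lt_min hδ (by positivity))
  obtain ⟨c, hc, η, hηθ, hsys⟩ := exists_cubeSystem (fun j => f₀ (p j)) hr0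
    (θ := r / 8) (by positivity)
  have hη := hsys.pos
  have hcf : ∀ j x, dist x (p j) < δ → dist (c j) (f₀ x) ≤ r / 4 := by
    intro j x hx
    have h1 := hf₀ (a := p j) (b := x) (by rwa [dist_comm])
    linarith [dist_triangle (c j) (f₀ (p j)) (f₀ x), hc j]
  obtain ⟨f₁, hf₁c, hf₁⟩ := exists_glue_pi (fun j => isClosed_closedBall) hdisj
    (fun j => ContinuousMap.const K (c j)) f₀ (ε := r / 4) (by positivity)
    fun j x hx => hcf j x ((mem_closedBall.1 hx).trans_lt (hρδ.trans_le (min_le_left _ _)))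
  obtain ⟨f, hff, hfo, hst⟩ := exists_stable_cubes hΛ hyp hρ hρW hdisj f₁ hf₁c hη
    (r := r) (by linarith)
  refine ⟨f, ?_, η, hη, fun g hg => ?_⟩
  · have : dist f f₀ ≤ r + r / 4 := (ContinuousMap.dist_le (by positivity)).2 fun x =>
      (dist_triangle _ (f₁ x) _).trans (add_le_add (hff x) (hf₁ x))
    linarith
  have hgf : ∀ x, dist (g x) (f x) < η := fun x =>
    (ContinuousMap.dist_apply_le_dist x).trans_lt hg
  have hcase : ∀ x ∈ W, (∃ j, dist (g x) (c j) < r - η) ∨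
      ∃ j, x ∈ ball (p j) ρ ∧ dist (g x) (c j) ≤ r + η := by
    intro x hx
    by_cases hxb : ∃ j, x ∈ ball (p j) ρ
    · obtain ⟨j, hj⟩ := hxb
      refine Or.inr ⟨j, hj, ?_⟩
      have h1 := hff x
      rw [hf₁c j x (ball_subset_closedBall hj)] at h1
      change dist (f x) (c j) ≤ r at h1
      linarith [dist_triangle (g x) (f x) (c j), hgf x]
    · push Not at hxb
      obtain ⟨j, hj⟩ := hcov x hx
      refine Or.inl ⟨j, ?_⟩
      have h1 := hcf j x (hj.trans_le (min_le_left _ _))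
      have h2 := hf₁ x
      have h3 := hgf x
      rw [hfo x hxb] at h3
      rw [dist_comm] at h1
      linarith [dist_triangle4 (g x) (f₁ x) (f₀ x) (c j)]
  have hnear : ∀ x ∈ W, ∃ j, dist (g x) (c j) ≤ r + η := by
    intro x hx
    rcases hcase x hx with ⟨j, hj⟩ | ⟨j, -, hj⟩
    · exact ⟨j, by linarith⟩
    · exact ⟨j, hj⟩
  refine ⟨fun y hy => ?_, fun x hxW hxg hns => ?_, fun x hx => ?_⟩
  · obtain ⟨y', hy', hs⟩ := hsys.exists_shift y
    obtain ⟨x, hx, rfl⟩ := hy (mem_closedBall.2 (hy'.trans (by linarith)))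
    obtain ⟨j, hj⟩ := hnear x hx
    exact hst g hg j y (hs j hj)
  · have h1 : ∀ a, ∃ j, x a ∈ ball (p j) ρ ∧ dist (g (x 0)) (c j) ≤ r + η := by
      intro a
      have := hcase (x a) (hxW a)
      rw [hxg a] at this
      exact this.resolve_left fun ⟨j, hj⟩ => hns (hst g hg j _ hj)
    choose J hJ1 hJ2 using h1
    obtain ⟨a, b, hab, hJ⟩ := hsys.exists_ne_of_near
      (fun a h => hns (hst g hg (J a) _ h)) hJ2
    refine ⟨a, b, hab, ?_⟩
    have e1 := mem_ball.1 (hJ1 a)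
    have e2 := mem_ball.1 (hJ1 b)
    rw [← hJ] at e2
    have e3 := hρδ.trans_le (min_le_right _ _)
    linarith [dist_triangle_right (x a) (x b) (p (J a))]
  · obtain ⟨j, hj⟩ := hnear x hx
    refine ⟨c j, ?_, hst g hg j _ ?_⟩
    · rw [dist_comm]
      linarith
    · rw [dist_self]
      linarith [hsys.le]

/-- If every nonempty open subset of `W` carries a map all of whose perturbations have a zero
set with some property `Λ i`, then the fibres of a generic map over interior points of the image
of `W` have such a property, and the fibres over the remaining points are finite. -/
theorem eventually_stableFiber [CompactSpace K] {n : ℕ} {ι : Type*}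
    {Λ : ι → Set K → Prop} (hΛ : ∀ i A B, A ⊆ B → Λ i A → Λ i B) {W : Set K} (hW : IsOpen W)
    (hyp : ∀ V, IsOpen V → V.Nonempty → V ⊆ W → ∃ i, ∃ ψ : C(K, Fin n → ℝ), ∃ η > 0,
      ∀ g : C(K, Fin n → ℝ), dist g ψ < η → Λ i ({x | g x = 0} ∩ V)) :
    ∀ᶠ g : C(K, Fin n → ℝ) in residual C(K, Fin n → ℝ),
      (∀ y ∈ interior (g '' W), StableFiber Λ W g y) ∧
      (∀ y, ¬ StableFiber Λ W g y → ({x | g x = y} ∩ W).Finite) ∧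
      g '' W ⊆ closure {y | StableFiber Λ W g y} := by
  have h1 := eventually_countable_forall.2 fun m : ℕ =>
    eventually_stableFiber_scale hΛ hW hyp (τ := 1 / ((m : ℝ) + 1)) (by positivity)
  filter_upwards [h1] with g hg
  refine ⟨fun y hy => ?_, fun y hy => ?_, ?_⟩
  · obtain ⟨s, hs, hsub⟩ := Metric.isOpen_iff.1 isOpen_interior y hy
    obtain ⟨m, hm⟩ := exists_nat_one_div_lt hs
    exact (hg m).1 y (((closedBall_subset_ball hm).trans hsub).trans interior_subset)
  · by_contra hinf
    obtain ⟨x, hx, m, hm⟩ := exists_separated hinf (n + 1)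
    have e : ∀ a, g (x a) = y := fun a => (hx a).1
    obtain ⟨a, b, hab, hlt⟩ := (hg m).2.1 x (fun a => (hx a).2) (fun a => by rw [e, e])
      (by rwa [e])
    exact absurd hlt (not_lt.2 (hm a b hab))
  · rintro _ ⟨x, hx, rfl⟩
    refine Metric.mem_closure_iff.2 fun s hs => ?_
    obtain ⟨m, hm⟩ := exists_nat_one_div_lt hs
    obtain ⟨y, hy, hst⟩ := (hg m).2.2 x hx
    exact ⟨y, hst, by rw [dist_comm]; exact hy.trans hm⟩

end Fill

section DStar

variable {K : Type*} [MetricSpace K]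

lemma dStar_le {dim : Set K → EReal} {n : ℕ} {V : Set K} {Z : ℕ → Set K}
    (hZ : ∀ k, IsClosed (Z k)) (h : indBelow n ↥(V ∩ ⋃ k, Z k)) :
    dStar dim n V ≤ dim (V \ ⋃ k, Z k) := by
  refine sInf_le ⟨V ∩ ⋃ k, Z k, ⟨Z, hZ, ?_⟩, tdim_le_iff.2 h, ?_⟩
  · rw [← iUnion_inter, inter_comm]
  · rw [sdiff_self_inter]

lemma not_indBelow_of_dStar_pos {dim : Set K → EReal} (h0 : dim ∅ ≤ 0) {n : ℕ} {V : Set K}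
    (h : 0 < dStar dim n V) : ¬ indBelow n ↥V := by
  intro hV
  have hU : V ∩ ⋃ _ : ℕ, univ = V := by rw [iUnion_const, inter_univ]
  have := dStar_le (dim := dim) (n := n) (V := V) (Z := fun _ : ℕ => univ)
    (fun _ => isClosed_univ) (by rwa [hU])
  rw [iUnion_const, sdiff_univ] at this
  exact absurd (this.trans h0) (not_le.2 h)

end DStar

section Hypotheses

variable {K : Type u} [MetricSpace K] [CompactSpace K]

/-- Negation of the local stability hypothesis in `eventually_stableFiber`. -/
lemma exists_stable_or_dense {E : Type*} [MetricSpace E] (P : E → Prop) :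
    (∃ ψ : E, ∃ η > 0, ∀ g : E, dist g ψ < η → P g) ∨ Dense {g | ¬ P g} := by
  by_contra! hcon
  obtain ⟨h1, h2⟩ := hcon
  refine h2 (Metric.dense_iff.2 fun ψ η hη => ?_)
  obtain ⟨g, hg, hP⟩ := h1 ψ η hη
  exact ⟨g, hg, hP⟩

lemma exists_stable_zero {n : ℕ} {V : Set K} (hV : IsOpen V) (h : ¬ indBelow n ↥V) :
    ∃ ψ : C(K, Fin n → ℝ), ∃ η > 0, ∀ g : C(K, Fin n → ℝ), dist g ψ < η →
      ({x | g x = 0} ∩ V).Nonempty := by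
  refine (exists_stable_or_dense _).resolve_right fun hd => h ?_
  obtain ⟨C, hC, -, hCV, -⟩ := hV.exists_iUnion_isClosed
  rw [← hCV]
  refine indBelow_iUnion (fun k => (hC k).isCompact) fun k => hd.mono fun g hg x hx h0 => ?_
  exact hg ⟨x, h0, hCV.subset (mem_iUnion.2 ⟨k, hx⟩)⟩

lemma Avoids.of_dense_indBelow {n s : ℕ} {A : Set K} (hA : IsCompact A)
    (h : Dense {g : C(K, Fin n → ℝ) | indBelow s ↥({x | g x = 0} ∩ A)}) : Avoids (n + s) A := by
  rw [Avoids, Metric.dense_iff]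
  intro f ε hε
  obtain ⟨g, hg, hgd⟩ := h.exists_dist_lt (⟨fun x a => f x (Fin.castAdd s a), by fun_prop⟩)
    (half_pos hε)
  have hc : IsCompact ({x | g x = 0} ∩ A) :=
    hA.inter_left (isClosed_eq g.continuous continuous_const)
  obtain ⟨k, hk, hkd⟩ := (indBelow.avoids hc hg).exists_dist_lt
    (⟨fun x a => f x (Fin.natAdd n a), by fun_prop⟩) (half_pos hε)
  refine ⟨⟨fun x => Fin.append (g x) (k x), continuous_pi fun i => ?_⟩, ?_, fun x hx h0 => ?_⟩
  · induction i using Fin.addCases with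
    | left a =>
      simp only [Fin.append_left]
      fun_prop
    | right a =>
      simp only [Fin.append_right]
      fun_prop
  · refine mem_ball.2 (lt_of_le_of_lt ((ContinuousMap.dist_le (half_pos hε).le).2 fun x =>
      (dist_pi_le_iff (half_pos hε).le).2 fun i => ?_) (half_lt_self hε))
    rw [dist_comm]
    induction i using Fin.addCases with
    | left a =>
      simp only [ContinuousMap.coe_mk, Fin.append_left]
      exact (dist_le_pi_dist _ (g x) a).trans ((ContinuousMap.dist_apply_le_dist x).trans hgd.le)
    | right a =>
      simp only [ContinuousMap.coe_mk, Fin.append_right]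
      exact (dist_le_pi_dist _ (k x) a).trans ((ContinuousMap.dist_apply_le_dist x).trans hkd.le)
  · refine hk x ⟨?_, hx⟩ ?_
    · ext a
      simpa using congrFun h0 (Fin.castAdd s a)
    · ext a
      simpa using congrFun h0 (Fin.natAdd n a)

lemma exists_stable_indBelow {n s : ℕ} {V : Set K} (hV : IsOpen V)
    (h : (s : EReal) - 1 < dStar tdim n V) :
    ∃ ψ : C(K, Fin n → ℝ), ∃ η > 0, ∀ g : C(K, Fin n → ℝ), dist g ψ < η →
      ¬ indBelow s ↥({x | g x = 0} ∩ V) := by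
  refine (exists_stable_or_dense _).resolve_right fun hd => ?_
  obtain ⟨C, hC, -, hCV, -⟩ := hV.exists_iUnion_isClosed
  obtain ⟨Z, hZ, h1, h2⟩ := exists_indBelow_split (n := n) (s := s) (fun k => (hC k).isCompact)
    fun k => Avoids.of_dense_indBelow (hC k).isCompact (hd.mono fun g hg => by
      refine (not_not.1 hg).subset (inter_subset_inter_right _ ?_)
      exact (subset_iUnion C k).trans hCV.subset)
  rw [hCV] at h1 h2
  exact absurd ((dStar_le hZ h1).trans (tdim_le_iff.2 h2)) (not_le.2 h)

open MeasureTheory Measure in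
lemma exists_open_cover_of_hausdorffMeasure_eq_zero {X : Type*} [MetricSpace X]
    [MeasurableSpace X] [BorelSpace X] {s : ℝ} (hs : 0 < s) {A : Set X} (hA : μH[s] A = 0)
    {δ : ℝ≥0∞} (hδ : 0 < δ) :
    ∃ t : ℕ → Set X, (∀ k, IsOpen (t k)) ∧ A ⊆ ⋃ k, t k ∧ (∀ k, ediam (t k) ≤ δ) ∧
      ∑' k, ediam (t k) ^ s ≤ δ := by
  have hδ2 : 0 < δ / 2 := ENNReal.half_pos hδ.ne'
  rw [hausdorffMeasure_apply] at hA
  have h1 := iSup₂_eq_bot.1 (bot_unique hA.le) (min (δ / 2) 1) (lt_min hδ2 one_pos)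
  have h2 := h1.trans_lt hδ2
  simp only [iInf_lt_iff] at h2
  obtain ⟨t, htA, htd, hts⟩ := h2
  obtain ⟨e, he0, hes⟩ := ENNReal.exists_pos_sum_of_countable' hδ2.ne' ℕ
  have hρ : ∀ k, ∃ ρ : ℝ, 0 < ρ ∧ ediam (thickening ρ (t k)) ≤ δ ∧
      ediam (thickening ρ (t k)) ^ s ≤ (⨆ _ : (t k).Nonempty, ediam (t k) ^ s) + e k := by
    intro k
    rcases (t k).eq_empty_or_nonempty with h0 | hne
    · exact ⟨1, one_pos, by simp [h0], by simp [h0, hs]⟩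
    have hfin : ediam (t k) ≠ ∞ := ((htd k).trans (min_le_right _ _)).trans_lt ENNReal.one_lt_top |>.ne
    have hlim : Tendsto (fun ρ : ℝ≥0 => ediam (t k) + 2 * (ρ : ℝ≥0∞)) (𝓝[>] 0)
        (𝓝 (ediam (t k))) := by
      have hc : Continuous fun ρ : ℝ≥0 => ediam (t k) + 2 * (ρ : ℝ≥0∞) := by
        refine continuous_const.add ?_
        exact (ENNReal.continuous_const_mul (by simp)).comp ENNReal.continuous_coe
      have := hc.tendsto 0
      simp only [ENNReal.coe_zero, mul_zero, add_zero] at this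
      exact this.mono_left nhdsWithin_le_nhds
    have hle : ∀ ρ : ℝ≥0, ediam (thickening (ρ : ℝ) (t k)) ≤ ediam (t k) + 2 * (ρ : ℝ≥0∞) := by
      intro ρ
      exact ediam_thickening_le ρ
    have ev1 : ∀ᶠ ρ : ℝ≥0 in 𝓝[>] 0, ediam (t k) + 2 * (ρ : ℝ≥0∞) < ediam (t k) + δ / 2 :=
      hlim.eventually_lt_const (ENNReal.lt_add_right hfin hδ2.ne')
    have hfin' : ediam (t k) ^ s ≠ ∞ := ENNReal.rpow_ne_top_of_nonneg hs.le hfin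
    have ev2 : ∀ᶠ ρ : ℝ≥0 in 𝓝[>] 0,
        (ediam (t k) + 2 * (ρ : ℝ≥0∞)) ^ s < ediam (t k) ^ s + e k :=
      ((ENNReal.continuous_rpow_const.tendsto _).comp hlim).eventually_lt_const
        (ENNReal.lt_add_right hfin' (he0 k).ne')
    obtain ⟨ρ, hρ0, hρ1, hρ2⟩ := (eventually_mem_nhdsWithin.and (ev1.and ev2)).exists
    refine ⟨ρ, NNReal.coe_pos.2 hρ0, (hle ρ).trans (hρ1.le.trans ?_), ?_⟩
    · calc ediam (t k) + δ / 2 ≤ δ / 2 + δ / 2 := by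
            gcongr
            exact (htd k).trans (min_le_left _ _)
        _ = δ := ENNReal.add_halves δ
    · rw [iSup_pos hne]
      exact (ENNReal.rpow_le_rpow (hle ρ) hs.le).trans hρ2.le
  choose ρ hρ0 hρ1 hρ2 using hρ
  refine ⟨fun k => thickening (ρ k) (t k), fun k => isOpen_thickening, htA.trans
    (iUnion_mono fun k => self_subset_thickening (hρ0 k) _), hρ1, ?_⟩
  calc ∑' k, ediam (thickening (ρ k) (t k)) ^ s
      ≤ ∑' k, ((⨆ _ : (t k).Nonempty, ediam (t k) ^ s) + e k) := ENNReal.tsum_le_tsum hρ2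
    _ = (∑' k, ⨆ _ : (t k).Nonempty, ediam (t k) ^ s) + ∑' k, e k := ENNReal.tsum_add
    _ ≤ δ / 2 + δ / 2 := add_le_add hts.le hes.le
    _ = δ := ENNReal.add_halves δ

open MeasureTheory Measure in
lemma exists_isOpen_iInter_of_hausdorffMeasure_eq_zero {X : Type*} [MetricSpace X]
    [MeasurableSpace X] [BorelSpace X] {s : ℝ} (hs : 0 < s) {A : Set X} (hA : μH[s] A = 0) :
    ∃ U : ℕ → Set X, (∀ k, IsOpen (U k)) ∧ A ⊆ ⋂ k, U k ∧ μH[s] (⋂ k, U k) = 0 := by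
  have hpos : ∀ k : ℕ, (0 : ℝ≥0∞) < ((k : ℝ≥0∞) + 1)⁻¹ := fun k =>
    ENNReal.inv_pos.2 (by finiteness)
  choose t ht1 ht2 ht3 ht4 using fun k : ℕ =>
    exists_open_cover_of_hausdorffMeasure_eq_zero hs hA (hpos k)
  have hlim : Tendsto (fun k : ℕ => ((k : ℝ≥0∞) + 1)⁻¹) atTop (𝓝 0) := by
    have := ENNReal.tendsto_inv_nat_nhds_zero.comp (tendsto_add_atTop_nat 1)
    simpa [Function.comp_def] using this
  refine ⟨fun k => ⋃ j, t k j, fun k => isOpen_iUnion (ht1 k), subset_iInter ht2, ?_⟩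
  have h := hausdorffMeasure_le_liminf_tsum (l := atTop) s (⋂ k, ⋃ j, t k j) _ hlim t
    (Eventually.of_forall ht3) (Eventually.of_forall fun k => iInter_subset _ k)
  refine le_antisymm (h.trans ?_) bot_le
  calc liminf (fun k => ∑' j, ediam (t k j) ^ s) atTop
      ≤ liminf (fun k : ℕ => ((k : ℝ≥0∞) + 1)⁻¹) atTop :=
        liminf_le_liminf (Eventually.of_forall ht4)
    _ = 0 := hlim.liminf_eq

open MeasureTheory Measure in
lemma exists_stable_hausdorffMeasure [MeasurableSpace K] [BorelSpace K] {n : ℕ} {s : ℝ≥0}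
    (hs : 0 < s) {V : Set K} (hV : IsOpen V) (h : ((s : ℝ) : EReal) < dStar hdim n V) :
    ∃ ψ : C(K, Fin n → ℝ), ∃ η > 0, ∀ g : C(K, Fin n → ℝ), dist g ψ < η →
      μH[s] ({x | g x = 0} ∩ V) ≠ 0 := by
  refine (exists_stable_or_dense _).resolve_right fun hd => ?_
  simp only [not_not] at hd
  obtain ⟨T, hTs, hTc, hTd⟩ := hd.exists_countable_dense_subset
  have hA : μH[s] (⋃ g ∈ T, {x | g x = 0} ∩ V) = 0 :=
    (measure_biUnion_null_iff hTc).2 fun g hg => hTs hg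
  obtain ⟨U, hU, hAU, hU0⟩ := exists_isOpen_iInter_of_hausdorffMeasure_eq_zero
    (NNReal.coe_pos.2 hs) hA
  obtain ⟨C, hC, -, hCV, -⟩ := hV.exists_iUnion_isClosed
  have hdiff : V \ ⋃ k, (U k)ᶜ ⊆ ⋂ k, U k := fun x hx => by
    simpa using hx.2
  have hI : indBelow n ↥(V ∩ ⋃ k, (U k)ᶜ) := by
    have : V ∩ ⋃ k, (U k)ᶜ = ⋃ m : ℕ, C m.unpair.1 ∩ (U m.unpair.2)ᶜ := by
      ext x
      simp only [← hCV, mem_inter_iff, mem_iUnion]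
      constructor
      · rintro ⟨⟨i, hi⟩, k, hk⟩
        exact ⟨Nat.pair i k, by simpa using hi, by simpa using hk⟩
      · rintro ⟨m, hi, hk⟩
        exact ⟨⟨_, hi⟩, _, hk⟩
    rw [this]
    refine indBelow_iUnion (fun m => ((hC _).inter (hU _).isClosed_compl).isCompact) fun m =>
      hTd.mono fun g hg x hx h0 => hx.2 ?_
    exact mem_iInter.1 (hAU (mem_biUnion hg ⟨h0, hCV.subset (mem_iUnion.2 ⟨_, hx.1⟩)⟩)) _
  refine absurd ((dStar_le (fun k => (hU k).isClosed_compl) hI).trans ?_) (not_le.2 h)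
  rw [hdim]
  split_ifs with he
  · exact (by simp : (-1 : EReal) ≤ 0).trans (EReal.coe_nonneg.2 s.2)
  · have h0 : μH[s] (V \ ⋃ k, (U k)ᶜ) = 0 := measure_mono_null hdiff hU0
    have := dimH_le_of_hausdorffMeasure_ne_top (d := s) (by rw [h0]; simp)
    rw [← EReal.coe_nnreal_eq_coe_real]
    exact EReal.coe_ennreal_le_coe_ennreal_iff.2 this

end Hypotheses

section PackingSums

variable {K : Type*} [MetricSpace K]

lemma packPre_mono_radius (h : ℝ≥0 → ℝ≥0) (A : Set K) {δ δ' : ℝ≥0} (hδ : δ ≤ δ') :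
    packPre h A δ ≤ packPre h A δ' :=
  iSup₂_le fun s hs => le_iSup₂_of_le s
    ⟨hs.1, fun p hp => ⟨(hs.2.1 p hp).1, (hs.2.1 p hp).2.trans hδ⟩, hs.2.2⟩ le_rfl

lemma exists_packMeasure_eq_top_of_lt_pdim {V : Set K} (hV : V.Nonempty) {t : ℝ≥0}
    (h : ((t : ℝ) : EReal) < pdim V) :
    ∃ t' > t, packMeasure (fun r => r ^ (t' : ℝ)) V = ∞ := by
  rw [pdim, if_neg hV.ne_empty] at h
  rcases lt_max_iff.1 h with h | h
  · exact absurd h (not_lt.2 (EReal.coe_nonneg.2 t.2))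
  · simp only [lt_iSup_iff] at h
    obtain ⟨t', h1, h2⟩ := h
    exact ⟨t', by exact_mod_cast h2, h1⟩

lemma exists_finset_packing {V : Set K} (hV : V.Nonempty) {t : ℝ≥0}
    (h : ((t : ℝ) : EReal) < pdim V) {δ : ℝ≥0} (hδ : 0 < δ) (hδ1 : δ ≤ 1) :
    ∃ p : Finset (K × ℝ≥0), (∀ q ∈ p, q.1 ∈ V ∧ 0 < q.2 ∧ q.2 ≤ δ) ∧
      ((p : Set (K × ℝ≥0)).Pairwise fun a b =>
        Disjoint (closedBall a.1 (a.2 : ℝ)) (closedBall b.1 (b.2 : ℝ))) ∧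
      1 ≤ ∑ q ∈ p, q.2 ^ (t : ℝ) := by
  classical
  obtain ⟨t', ht', hP⟩ := exists_packMeasure_eq_top_of_lt_pdim hV h
  have ht0 : 0 < t' := bot_le.trans_lt ht'
  have h0 : packPre0 (fun r => r ^ (t' : ℝ)) V = ∞ := by
    have := packMeasure_le_tsum (fun r => r ^ (t' : ℝ)) (A := V)
      (c := fun i => if i = 0 then V else ∅) (fun x hx => mem_iUnion.2 ⟨0, by simpa using hx⟩)
    rw [hP, top_le_iff, tsum_eq_single 0 fun i hi => by
      rw [if_neg hi]; exact packPre0_subsingleton ht0 subsingleton_empty] at this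
    simpa using this
  have h1 : 1 < packPre (fun r => r ^ (t' : ℝ)) V δ :=
    ENNReal.one_lt_top.trans_le (h0.symm.le.trans (iInf₂_le δ hδ))
  rw [packPre] at h1
  simp only [lt_iSup_iff] at h1
  obtain ⟨s, hs, h2⟩ := h1
  rw [ENNReal.tsum_eq_iSup_sum, lt_iSup_iff] at h2
  obtain ⟨F, hF⟩ := h2
  have hsub : ∀ q ∈ (F.map (Function.Embedding.subtype _)).filter (fun q => 0 < q.2), q ∈ s := by
    intro q hq
    obtain ⟨a, -, rfl⟩ := Finset.mem_map.1 (Finset.mem_filter.1 hq).1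
    exact a.2
  refine ⟨(F.map (Function.Embedding.subtype _)).filter (fun q => 0 < q.2), fun q hq =>
    ⟨(hs.2.1 q (hsub q hq)).1, (Finset.mem_filter.1 hq).2, (hs.2.1 q (hsub q hq)).2⟩,
    hs.2.2.mono hsub, ?_⟩
  have h3 : 1 < ∑ q ∈ F.map (Function.Embedding.subtype _), q.2 ^ (t' : ℝ) := by
    rw [Finset.sum_map]
    exact_mod_cast hF
  have h4 : ∑ q ∈ F.map (Function.Embedding.subtype _), q.2 ^ (t' : ℝ) =
      ∑ q ∈ (F.map (Function.Embedding.subtype _)).filter (fun q => 0 < q.2),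
        q.2 ^ (t' : ℝ) := by
    refine (Finset.sum_filter_of_ne fun q _ hq => ?_).symm
    refine pos_iff_ne_zero.2 fun h0 => hq ?_
    rw [h0, NNReal.zero_rpow (by exact_mod_cast ht0.ne')]
  refine h3.le.trans (h4.le.trans (Finset.sum_le_sum fun q hq => ?_))
  exact NNReal.rpow_le_rpow_of_exponent_ge (Finset.mem_filter.1 hq).2
    ((hs.2.1 q (hsub q hq)).2.trans hδ1) (by exact_mod_cast ht'.le)

lemma one_le_mul_packPre {p : Finset (K × ℝ≥0)} {s t δ : ℝ≥0} (hst : s ≤ t)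
    (hp : ∀ q ∈ p, 0 < q.2 ∧ q.2 ≤ δ)
    (hd : (p : Set (K × ℝ≥0)).Pairwise fun a b =>
      Disjoint (closedBall a.1 (a.2 : ℝ)) (closedBall b.1 (b.2 : ℝ)))
    (h1 : 1 ≤ ∑ q ∈ p, q.2 ^ (t : ℝ)) {c : Set K}
    (hc : ∀ q ∈ p, ∃ x ∈ c, dist x q.1 ≤ (q.2 : ℝ) / 2) :
    1 ≤ ((δ ^ ((t : ℝ) - s) * 2 ^ (s : ℝ) : ℝ≥0) : ℝ≥0∞) *
      packPre (fun r => r ^ (s : ℝ)) c δ := by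
  classical
  have : Nonempty K := by
    obtain ⟨q, -⟩ : p.Nonempty := by
      by_contra hne
      rw [Finset.not_nonempty_iff_eq_empty.1 hne, Finset.sum_empty] at h1
      exact absurd h1 (by norm_num)
    exact ⟨q.1⟩
  choose! x hxc hx using hc
  have hball : ∀ q ∈ p, closedBall (x q) ((q.2 / 2 : ℝ≥0) : ℝ) ⊆ closedBall q.1 (q.2 : ℝ) := by
    intro q hq
    refine closedBall_subset_closedBall' ?_
    have := hx q hq
    push_cast
    linarith
  have hinj : Set.InjOn (fun q : K × ℝ≥0 => (x q, q.2 / 2)) p := by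
    intro a ha b hb hab
    by_contra hne
    have hxab : x a = x b := congrArg Prod.fst hab
    exact Set.disjoint_left.1 (hd ha hb hne) (hball a ha (mem_closedBall_self (by positivity)))
      (hxab ▸ hball b hb (mem_closedBall_self (by positivity)))
  have hpack : IsPacking c δ ((p.image fun q => (x q, q.2 / 2) : Finset (K × ℝ≥0)) :
      Set (K × ℝ≥0)) := by
    refine ⟨Finset.countable_toSet _, ?_, ?_⟩
    · intro a ha
      obtain ⟨q, hq, rfl⟩ := Finset.mem_image.1 (Finset.mem_coe.1 ha)
      exact ⟨hxc q hq, (NNReal.half_le_self _).trans (hp q hq).2⟩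
    · rw [Finset.coe_image]
      rintro _ ⟨a, ha, rfl⟩ _ ⟨b, hb, rfl⟩ hab
      exact (hd ha hb fun h => hab (h ▸ rfl)).mono (hball a ha) (hball b hb)
  have hle : ((∑ q ∈ p, (q.2 / 2) ^ (s : ℝ) : ℝ≥0) : ℝ≥0∞) ≤
      packPre (fun r => r ^ (s : ℝ)) c δ := by
    refine le_trans (le_of_eq ?_) (le_iSup₂_of_le _ hpack le_rfl)
    rw [Finset.tsum_subtype' _ fun q : K × ℝ≥0 => ((q.2 ^ (s : ℝ) : ℝ≥0) : ℝ≥0∞),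
      Finset.sum_image hinj]
    push_cast
    rfl
  refine le_trans ?_ (mul_le_mul_right hle _)
  have key : 1 ≤ (δ ^ ((t : ℝ) - s) * 2 ^ (s : ℝ)) * ∑ q ∈ p, (q.2 / 2) ^ (s : ℝ) := by
    refine h1.trans ?_
    rw [Finset.mul_sum]
    refine Finset.sum_le_sum fun q hq => ?_
    rw [mul_assoc, ← NNReal.mul_rpow, mul_div_cancel₀ _ (two_ne_zero)]
    calc q.2 ^ (t : ℝ) = q.2 ^ ((t : ℝ) - s) * q.2 ^ (s : ℝ) := by
          rw [← NNReal.rpow_add (hp q hq).1.ne', sub_add_cancel]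
      _ ≤ _ := by
          gcongr
          · exact sub_nonneg.2 (by exact_mod_cast hst)
          · exact (hp q hq).2
  exact_mod_cast key

lemma packPre0_eq_top {s t : ℝ≥0} (hst : s < t) {c : Set K} {δ : ℕ → ℝ≥0}
    (hδ : Tendsto δ atTop (𝓝 0))
    (h : ∀ k, 1 ≤ ((δ k ^ ((t : ℝ) - s) * 2 ^ (s : ℝ) : ℝ≥0) : ℝ≥0∞) *
      packPre (fun r => r ^ (s : ℝ)) c (δ k)) :
    packPre0 (fun r => r ^ (s : ℝ)) c = ∞ := by
  refine iInf₂_eq_top.2 fun ε hε => ?_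
  by_contra hne
  have hpos : (0 : ℝ) < (t : ℝ) - s := sub_pos.2 (by exact_mod_cast hst)
  have hlim : Tendsto (fun k => ((δ k ^ ((t : ℝ) - s) * 2 ^ (s : ℝ) : ℝ≥0) : ℝ≥0∞) *
      packPre (fun r => r ^ (s : ℝ)) c ε) atTop (𝓝 0) := by
    have h1 : Tendsto (fun k => δ k ^ ((t : ℝ) - s) * 2 ^ (s : ℝ)) atTop (𝓝 0) := by
      have := ((NNReal.continuousAt_rpow_const (Or.inr hpos.le)).tendsto.comp hδ).mul_const
        ((2 : ℝ≥0) ^ (s : ℝ))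
      simpa [Function.comp_def, NNReal.zero_rpow hpos.ne'] using this
    have := ENNReal.Tendsto.mul_const (ENNReal.tendsto_coe.2 h1) (Or.inr hne)
    simpa using this
  obtain ⟨k, hk1, hk2⟩ := ((hlim.eventually_lt_const one_pos).and
    (hδ.eventually_lt_const hε)).exists
  exact absurd ((h k).trans (mul_le_mul_right (packPre_mono_radius _ c hk2.le) _)) (not_le.2 hk1)

end PackingSums

section PackingFibers

variable {K : Type u} [MetricSpace K] [CompactSpace K]

/-- The set `A` meets every set `i.2 q` attached to a ball `q` of the packing `i.1`, where the
radii in `i.1` are at most `δ` and the sum of their powers of order `t` is at least one. -/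
def HitsPacking (t δ : ℝ≥0) (W : Set K) (i : Finset (K × ℝ≥0) × (K × ℝ≥0 → Set K))
    (A : Set K) : Prop :=
  (∀ q ∈ i.1, 0 < q.2 ∧ q.2 ≤ δ) ∧
    ((i.1 : Set (K × ℝ≥0)).Pairwise fun a b =>
      Disjoint (closedBall a.1 (a.2 : ℝ)) (closedBall b.1 (b.2 : ℝ))) ∧
    1 ≤ ∑ q ∈ i.1, q.2 ^ (t : ℝ) ∧
    ∀ q ∈ i.1, i.2 q ∈ countableBasis K ∧ closure (i.2 q) ⊆ W ∧
      i.2 q ⊆ closedBall q.1 ((q.2 : ℝ) / 2) ∧ (i.2 q ∩ A).Nonempty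

lemma HitsPacking.mono {t δ : ℝ≥0} {W : Set K} {i : Finset (K × ℝ≥0) × (K × ℝ≥0 → Set K)}
    {A B : Set K} (hAB : A ⊆ B) (h : HitsPacking t δ W i A) : HitsPacking t δ W i B :=
  ⟨h.1, h.2.1, h.2.2.1, fun q hq => ⟨(h.2.2.2 q hq).1, (h.2.2.2 q hq).2.1, (h.2.2.2 q hq).2.2.1,
    (h.2.2.2 q hq).2.2.2.mono (inter_subset_inter_right _ hAB)⟩⟩

lemma exists_stable_hitsPacking {n : ℕ} {t δ : ℝ≥0} (hδ : 0 < δ) (hδ1 : δ ≤ 1) {V W : Set K}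
    (hV : IsOpen V) (hne : V.Nonempty) (hVW : V ⊆ W) (ht : ((t : ℝ) : EReal) < pdim V)
    (hind : ∀ U : Set K, IsOpen U → U.Nonempty → ¬ indBelow n ↥U) :
    ∃ i, ∃ ψ : C(K, Fin n → ℝ), ∃ η > 0, ∀ g : C(K, Fin n → ℝ), dist g ψ < η →
      HitsPacking t δ W i ({x | g x = 0} ∩ V) := by
  obtain ⟨p, hp, hpd, hp1⟩ := exists_finset_packing hne ht hδ hδ1
  have hB : ∀ q : p, ∃ B ∈ countableBasis K, q.1.1 ∈ B ∧ closure B ⊆ V ∧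
      closure B ⊆ closedBall q.1.1 ((q.1.2 : ℝ) / 2) := by
    intro q
    have hq : (0 : ℝ) < (q.1.2 : ℝ) / 2 := half_pos (NNReal.coe_pos.2 (hp q q.2).2.1)
    obtain ⟨F, ⟨hF, hFc⟩, hFs⟩ := (closed_nhds_basis q.1.1).mem_iff.1
      (inter_mem (hV.mem_nhds (hp q q.2).1) (closedBall_mem_nhds q.1.1 hq))
    obtain ⟨B, hB, hqB, hBF⟩ := (isBasis_countableBasis K).mem_nhds_iff.1 hF
    have hBF' : closure B ⊆ F := closure_minimal hBF hFc
    exact ⟨B, hB, hqB, hBF'.trans (hFs.trans inter_subset_left),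
      hBF'.trans (hFs.trans inter_subset_right)⟩
  choose B hB hqB hBV hBb using hB
  have hst : ∀ q : p, ∃ ψ : C(K, Fin n → ℝ), ∃ η > 0, ∀ g : C(K, Fin n → ℝ), dist g ψ < η →
      ({x | g x = 0} ∩ B q).Nonempty := fun q =>
    exists_stable_zero (isOpen_of_mem_countableBasis (hB q))
      (hind _ (isOpen_of_mem_countableBasis (hB q)) ⟨_, hqB q⟩)
  choose u η hη hu using hst
  have hdisj : Pairwise fun a b : p => Disjoint (closure (B a)) (closure (B b)) := by
    intro a b hab
    have hle : ∀ q : p, closure (B q) ⊆ closedBall q.1.1 (q.1.2 : ℝ) := fun q =>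
      (hBb q).trans (closedBall_subset_closedBall (half_le_self q.1.2.2))
    exact (hpd a.2 b.2 (Subtype.val_injective.ne hab)).mono (hle a) (hle b)
  obtain ⟨C, hC0, hC⟩ : ∃ C : ℝ, 0 ≤ C ∧ ∀ q, dist (u q) 0 ≤ C := by
    obtain ⟨C, hC⟩ := (Set.finite_range fun q => dist (u q) 0).bddAbove
    exact ⟨max C 0, le_max_right _ _, fun q => (hC ⟨q, rfl⟩).trans (le_max_left _ _)⟩
  obtain ⟨ψ, hψ, -⟩ := exists_glue_pi (fun q => isClosed_closure) hdisj u 0 hC0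
    fun q x _ => (ContinuousMap.dist_apply_le_dist x).trans (hC q)
  obtain ⟨ε, hε0, hε⟩ : ∃ ε > 0, ∀ q, ε < η q := by
    have : ∀ᶠ ε in 𝓝[>] (0 : ℝ), 0 < ε ∧ ∀ q, ε < η q :=
      (eventually_mem_nhdsWithin.mono fun ε h => h).and
        (eventually_all.2 fun q => (eventually_lt_const_nhdsGT (hη q) 1).mono fun ε h => by
          linarith)
    obtain ⟨ε, h1, h2⟩ := this.exists
    exact ⟨ε, h1, h2⟩
  classical
  refine ⟨(p, fun q => if hq : q ∈ p then B ⟨q, hq⟩ else ∅), ψ, ε, hε0, fun g hg =>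
    ⟨fun q hq => (hp q hq).2, hpd, hp1, fun q hq => ?_⟩⟩
  simp only [dif_pos hq]
  refine ⟨hB _, (hBV _).trans hVW, subset_closure.trans (hBb ⟨q, hq⟩), ?_⟩
  obtain ⟨x, hx0, hxB⟩ := hu ⟨q, hq⟩ (u ⟨q, hq⟩ + (g - ψ)) (by
    rw [dist_self_add_left, ← dist_eq_norm]
    exact hg.trans (hε _))
  refine ⟨x, hxB, ?_, hBV _ (subset_closure hxB)⟩
  have := hψ ⟨q, hq⟩ x (subset_closure hxB)
  simpa [this] using hx0

lemma packMeasure_fiber_eq_top {n : ℕ} {s t : ℝ≥0} (hst : s < t) {δ : ℕ → ℝ≥0}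
    (hδ : Tendsto δ atTop (𝓝 0)) {g : C(K, Fin n → ℝ)}
    (hg : ∀ k, ∀ W ∈ insert univ (countableBasis K), ∀ y ∈ interior (g '' W),
      StableFiber (HitsPacking t (δ k) W) W g y) {y : Fin n → ℝ} (hy : y ∈ interior (range g)) :
    packMeasure (fun r => r ^ (s : ℝ)) (g ⁻¹' {y}) = ∞ := by
  refine iInf₂_eq_top.2 fun c hc => ?_
  by_contra hne
  have hstep : ∀ W : {W // W ∈ insert univ (countableBasis K) ∧ y ∈ interior (g '' W)}, ∀ i,
      ∃ W' : {W // W ∈ insert univ (countableBasis K) ∧ y ∈ interior (g '' W)},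
        closure W'.1 ⊆ W.1 ∧ Disjoint (c i) W'.1 := by
    rintro ⟨W, hW, hyW⟩ i
    by_contra! hcon
    refine ENNReal.ne_top_of_tsum_ne_top hne i (packPre0_eq_top hst hδ fun k => ?_)
    obtain ⟨⟨p, B⟩, hev⟩ := hg k W hW y hyW
    obtain ⟨h1, h2, h3, h4⟩ := hev.self_of_nhds
    refine one_le_mul_packPre hst.le h1 h2 h3 fun q hq => ?_
    obtain ⟨hB, hBW, hBb, -⟩ := h4 q hq
    have hyB : y ∈ interior (g '' B q) := by
      refine mem_interior_iff_mem_nhds.2 ?_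
      filter_upwards [hev] with y' hy'
      obtain ⟨x, hxB, hx, -⟩ := (hy'.2.2.2 q hq).2.2.2
      exact ⟨x, hxB, hx⟩
    obtain ⟨x, hxc, hxB⟩ := Set.not_disjoint_iff.1
      (hcon ⟨B q, mem_insert_of_mem _ hB, hyB⟩ hBW)
    exact ⟨x, hxc, mem_closedBall.1 (hBb hxB)⟩
  choose S hS1 hS2 using hstep
  set w : ℕ → {W // W ∈ insert univ (countableBasis K) ∧ y ∈ interior (g '' W)} :=
    fun k => Nat.rec ⟨univ, mem_insert _ _, by rwa [image_univ]⟩ (fun k W => S W k) k with hw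
  have hw1 : ∀ k, closure (w (k + 1)).1 ⊆ (w k).1 := fun k => hS1 (w k) k
  have hw2 : ∀ k, Disjoint (c k) (w (k + 1)).1 := fun k => hS2 (w k) k
  have hfib : IsClosed (g ⁻¹' {y}) := isClosed_singleton.preimage g.continuous
  obtain ⟨x, hx⟩ := IsCompact.nonempty_iInter_of_sequence_nonempty_isCompact_isClosed
    (fun k => closure (w k).1 ∩ g ⁻¹' {y})
    (fun k => inter_subset_inter_left _ ((hw1 k).trans subset_closure))
    (fun k => by
      obtain ⟨x, hx, hxy⟩ := interior_subset (w k).2.2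
      exact ⟨x, subset_closure hx, hxy⟩)
    (isClosed_closure.inter hfib).isCompact (fun k => isClosed_closure.inter hfib)
  simp only [mem_iInter] at hx
  obtain ⟨i, hi⟩ := mem_iUnion.1 (hc.subset (hx 0).2)
  exact Set.disjoint_left.1 (hw2 i) hi (hw1 (i + 1) (hx (i + 2)).1)

lemma eventually_packMeasure_fiber {n : ℕ} {s t : ℝ≥0} (hst : s < t)
    (ht : ∀ V : Set K, IsOpen V → V.Nonempty → ((t : ℝ) : EReal) < pdim V)
    (hind : ∀ V : Set K, IsOpen V → V.Nonempty → ¬ indBelow n ↥V) :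
    ∀ᶠ g : C(K, Fin n → ℝ) in residual _, ∀ y ∈ interior (range g),
      packMeasure (fun r => r ^ (s : ℝ)) (g ⁻¹' {y}) = ∞ := by
  obtain ⟨δ, -, hδ, hlim⟩ := exists_seq_strictAnti_tendsto' (zero_lt_one (α := ℝ≥0))
  have hcount : (insert univ (countableBasis K)).Countable :=
    (countable_countableBasis K).insert _
  have hev : ∀ᶠ g : C(K, Fin n → ℝ) in residual _, ∀ k, ∀ W ∈ insert univ (countableBasis K),
      ∀ y ∈ interior (g '' W), StableFiber (HitsPacking t (δ k) W) W g y := by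
    refine eventually_countable_forall.2 fun k => (eventually_countable_ball hcount).2 fun W hW => ?_
    have hWo : IsOpen W := by
      rcases hW with rfl | hW
      · exact isOpen_univ
      · exact isOpen_of_mem_countableBasis hW
    filter_upwards [eventually_stableFiber (Λ := HitsPacking t (δ k) W)
      (fun i A B hAB h => h.mono hAB) hWo fun V hV hne hVW =>
        exists_stable_hitsPacking (hδ k).1 (hδ k).2.le hV hne hVW (ht V hV hne) hind] with g hg
    exact hg.1
  filter_upwards [hev] with g hg y hy
  exact packMeasure_fiber_eq_top hst hlim hg hy

end PackingFibers

section Dimension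

variable {K : Type u} [MetricSpace K]

/-- The properties shared by the topological, Hausdorff and packing dimensions that are needed
for upper bounds on fibres. -/
structure IsDimension (dim : Set K → EReal) : Prop where
  mono : ∀ {A B : Set K}, A ⊆ B → dim A ≤ dim B
  empty_le : dim ∅ ≤ 0
  le_of_diff_finite : ∀ {A B S : Set K}, IsClosed A → S.Finite → A \ S ⊆ B →
    dim A ≤ max 0 (dim B)

lemma isDimension_tdim [CompactSpace K] : IsDimension (tdim (X := K)) where
  mono := tdim_mono
  empty_le := (tdim_le_iff.2 (indBelow_of_isEmpty 0)).trans (by simp)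
  le_of_diff_finite := tdim_le_of_diff_finite

lemma isDimension_hdim : IsDimension (hdim (X := K)) where
  mono := hdim_mono
  empty_le := by simp [hdim]
  le_of_diff_finite _ := hdim_le_of_diff_finite

lemma isDimension_pdim : IsDimension (pdim (X := K)) where
  mono := pdim_mono
  empty_le := by simp [pdim]
  le_of_diff_finite _ := pdim_le_of_diff_finite

lemma IsDimension.finite_le {dim : Set K → EReal} (h : IsDimension dim) {A : Set K}
    (hA : A.Finite) : dim A ≤ 0 :=
  (h.le_of_diff_finite hA.isClosed hA (sdiff_self (a := A)).subset).trans
    (max_le le_rfl h.empty_le)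

lemma IsDimension.dStar_mono {dim : Set K → EReal} (h : IsDimension dim) (n : ℕ) {U V : Set K}
    (hUV : U ⊆ V) : dStar dim n U ≤ dStar dim n V := by
  refine le_sInf ?_
  rintro d ⟨F, ⟨C, hC, rfl⟩, hF, rfl⟩
  refine sInf_le_of_le ⟨⋃ i, C i ∩ U, ⟨C, hC, rfl⟩, (tdim_mono ?_).trans hF, rfl⟩ (h.mono ?_)
  · exact iUnion_mono fun i => inter_subset_inter_right _ hUV
  · rintro x ⟨hxU, hx⟩
    refine ⟨hUV hxU, fun hx' => hx ?_⟩
    obtain ⟨i, hi⟩ := mem_iUnion.1 hx'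
    exact mem_iUnion.2 ⟨i, hi.1, hxU⟩

lemma dStar_le_self (dim : Set K → EReal) (n : ℕ) (V : Set K) : dStar dim n V ≤ dim V := by
  have h := dStar_le (dim := dim) (n := n) (V := V) (Z := fun _ : ℕ => ∅)
    (fun _ => isClosed_empty) (by
      rw [iUnion_empty, inter_empty]
      exact indBelow_of_isEmpty n)
  rwa [iUnion_empty, sdiff_empty] at h

end Dimension

lemma le_of_forall_rat_lt {a b : EReal} (ha : 0 < a)
    (h : ∀ q : ℚ, 0 < q → ((q : ℝ) : EReal) < a → ((q : ℝ) : EReal) ≤ b) : a ≤ b := by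
  by_contra! hba
  obtain ⟨q, hq1, hq2⟩ := EReal.lt_iff_exists_rat_btwn.1 (max_lt ha hba)
  have hq0 : 0 < q := by exact_mod_cast (le_max_left _ _).trans_lt hq1
  exact absurd (h q hq0 hq2) (not_le.2 ((le_max_right _ _).trans_lt hq1))

section LowerBounds

variable {K : Type u} [MetricSpace K] [CompactSpace K]

/-- A property of zero sets that holds stably on every open set passes to the fibres over the
interior of the range of a generic map. -/
lemma eventually_fiber_of_stable {n : ℕ} {P : Set K → Prop} (hP : ∀ A B, A ⊆ B → P A → P B)
    (h : ∀ V : Set K, IsOpen V → V.Nonempty → ∃ ψ : C(K, Fin n → ℝ), ∃ η > 0,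
      ∀ g : C(K, Fin n → ℝ), dist g ψ < η → P ({x | g x = 0} ∩ V)) :
    ∀ᶠ g : C(K, Fin n → ℝ) in residual _, ∀ y ∈ interior (range g), P (g ⁻¹' {y}) := by
  filter_upwards [eventually_stableFiber (Λ := fun _ : Unit => P) (fun _ => hP) isOpen_univ
    fun V hV hne _ => ⟨(), h V hV hne⟩] with g hg y hy
  obtain ⟨_, hev⟩ := hg.1 y (by rwa [image_univ])
  exact hP _ _ inter_subset_left hev.self_of_nhds

lemma eventually_finite_or_mem_interior {n : ℕ}
    (h : ∀ V : Set K, IsOpen V → V.Nonempty → ¬ indBelow n ↥V) :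
    ∀ᶠ g : C(K, Fin n → ℝ) in residual _,
      (∀ y, y ∉ interior (range g) → (g ⁻¹' {y}).Finite) ∧
        range g ⊆ closure (interior (range g)) := by
  filter_upwards [eventually_stableFiber (Λ := fun _ : Unit => Set.Nonempty)
    (fun _ _ _ hAB hA => hA.mono hAB) isOpen_univ
    fun V hV hne _ => ⟨(), exists_stable_zero hV (h V hV hne)⟩] with g hg
  have hmem : ∀ y, StableFiber (fun _ : Unit => Set.Nonempty) univ g y →
      y ∈ interior (range g) := by
    rintro y ⟨_, hy⟩
    refine mem_interior_iff_mem_nhds.2 ?_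
    refine hy.mono fun y' hy' => ?_
    obtain ⟨x, hx, -⟩ := hy'
    exact ⟨x, hx⟩
  refine ⟨fun y hy => ?_, ?_⟩
  · have := hg.2.1 y (mt (hmem y) hy)
    rwa [inter_univ] at this
  · rw [← image_univ]
    refine hg.2.2.trans (closure_mono ?_)
    rw [image_univ]
    exact hmem

variable {n : ℕ} {d : EReal}

lemma eventually_le_tdim_fiber
    (h : ∀ V : Set K, IsOpen V → V.Nonempty → d ≤ dStar tdim n V) :
    ∀ᶠ g : C(K, Fin n → ℝ) in residual _, ∀ y ∈ interior (range g), d ≤ tdim (g ⁻¹' {y}) := by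
  have hev : ∀ᶠ g : C(K, Fin n → ℝ) in residual _, ∀ s : ℕ, (s : EReal) - 1 < d →
      ∀ y ∈ interior (range g), ¬ indBelow s ↥(g ⁻¹' {y}) := by
    refine eventually_countable_forall.2 fun s => ?_
    by_cases hs : (s : EReal) - 1 < d
    · filter_upwards [eventually_fiber_of_stable (n := n) (P := fun A : Set K => ¬ indBelow s ↥A)
        (fun A B hAB hA hB => hA (hB.subset hAB)) fun V hV hne =>
          exists_stable_indBelow hV (hs.trans_le (h V hV hne))] with g hg _
      exact hg
    · exact Eventually.of_forall fun g hs' => absurd hs' hs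
  filter_upwards [hev] with g hg y hy
  rcases tdim_eq_top_or (g ⁻¹' {y}) with htop | ⟨k, hk, hkd⟩
  · rw [htop]
    exact le_top
  · by_contra! hlt
    exact hg k (hkd ▸ hlt) y hy hk

open MeasureTheory Measure in
lemma eventually_le_hdim_fiber (hd : 0 < d)
    (h : ∀ V : Set K, IsOpen V → V.Nonempty → d ≤ dStar hdim n V) :
    ∀ᶠ g : C(K, Fin n → ℝ) in residual _, ∀ y ∈ interior (range g), d ≤ hdim (g ⁻¹' {y}) := by
  borelize K
  have hev : ∀ᶠ g : C(K, Fin n → ℝ) in residual _, ∀ q : ℚ, 0 < q → ((q : ℝ) : EReal) < d →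
      ∀ y ∈ interior (range g), μH[(q : ℝ)] (g ⁻¹' {y}) ≠ 0 := by
    refine eventually_countable_forall.2 fun q => ?_
    by_cases hq : 0 < q ∧ ((q : ℝ) : EReal) < d
    · obtain ⟨s, hs⟩ : ∃ s : ℝ≥0, (s : ℝ) = q := ⟨⟨q, by exact_mod_cast hq.1.le⟩, rfl⟩
      have hs0 : 0 < s := NNReal.coe_pos.1 (by rw [hs]; exact_mod_cast hq.1)
      filter_upwards [eventually_fiber_of_stable (n := n)
        (P := fun A : Set K => μH[(s : ℝ)] A ≠ 0)
        (fun A B hAB hA hB => hA (measure_mono_null hAB hB)) fun V hV hne =>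
          exists_stable_hausdorffMeasure hs0 hV (hs ▸ hq.2.trans_le (h V hV hne))] with g hg _ _
      exact hs ▸ hg
    · exact Eventually.of_forall fun g h1 h2 => absurd ⟨h1, h2⟩ hq
  filter_upwards [hev] with g hg y hy
  refine le_of_forall_rat_lt hd fun q hq0 hqd => ?_
  obtain ⟨s, hs⟩ : ∃ s : ℝ≥0, (s : ℝ) = q := ⟨⟨q, by exact_mod_cast hq0.le⟩, rfl⟩
  have hne := hg q hq0 hqd y hy
  rw [← hs] at hne ⊢
  have hle := le_dimH_of_hausdorffMeasure_ne_zero hne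
  have hne' : g ⁻¹' {y} ≠ ∅ := fun h0 => hne (by rw [h0, measure_empty])
  rw [hdim, if_neg hne', ← EReal.coe_nnreal_eq_coe_real]
  exact EReal.coe_ennreal_le_coe_ennreal_iff.2 hle

lemma eventually_le_pdim_fiber (hd : 0 < d)
    (h : ∀ V : Set K, IsOpen V → V.Nonempty → d ≤ dStar pdim n V) :
    ∀ᶠ g : C(K, Fin n → ℝ) in residual _, ∀ y ∈ interior (range g), d ≤ pdim (g ⁻¹' {y}) := by
  have hev : ∀ᶠ g : C(K, Fin n → ℝ) in residual _, ∀ q : ℚ, 0 < q → ((q : ℝ) : EReal) < d →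
      ∀ y ∈ interior (range g), ((q : ℝ) : EReal) ≤ pdim (g ⁻¹' {y}) := by
    refine eventually_countable_forall.2 fun q => ?_
    by_cases hq : 0 < q ∧ ((q : ℝ) : EReal) < d
    · obtain ⟨q', hq1, hq2⟩ := EReal.lt_iff_exists_rat_btwn.1 hq.2
      have hqq : (q : ℝ) < q' := by exact_mod_cast hq1
      have hq0 : (0 : ℝ) < q := by exact_mod_cast hq.1
      obtain ⟨s, hs⟩ : ∃ s : ℝ≥0, (s : ℝ) = q := ⟨⟨q, hq0.le⟩, rfl⟩
      obtain ⟨t, ht⟩ : ∃ t : ℝ≥0, (t : ℝ) = q' := ⟨⟨q', (hq0.trans hqq).le⟩, rfl⟩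
      have hst : s < t := NNReal.coe_lt_coe.1 (by rw [hs, ht]; exact hqq)
      filter_upwards [eventually_packMeasure_fiber (n := n) hst (fun V hV hne =>
        (ht ▸ hq2).trans_le ((h V hV hne).trans (dStar_le_self pdim n V))) fun V hV hne =>
          not_indBelow_of_dStar_pos isDimension_pdim.empty_le (hd.trans_le (h V hV hne))]
        with g hg _ _ y hy
      obtain ⟨x, hx⟩ := interior_subset hy
      have hne : g ⁻¹' {y} ≠ ∅ := (show (g ⁻¹' {y}).Nonempty from ⟨x, hx⟩).ne_empty
      rw [pdim, if_neg hne, ← hs]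
      exact le_max_of_le_right (le_iSup₂_of_le s (hg y hy) le_rfl)
    · exact Eventually.of_forall fun g h1 h2 => absurd ⟨h1, h2⟩ hq
  filter_upwards [hev] with g hg y hy
  exact le_of_forall_rat_lt hd fun q hq0 hqd => hg q hq0 hqd y hy

end LowerBounds

section UpperBounds

variable {K : Type u} [MetricSpace K] [CompactSpace K]

lemma eventually_finite_fibers_of_indBelow {n : ℕ} {A : ℕ → Set K} (hA : ∀ k, IsCompact (A k))
    (h : indBelow n ↥(⋃ k, A k)) :
    ∀ᶠ f : C(K, Fin n → ℝ) in residual _, ∀ y, ((⋃ k, A k) ∩ f ⁻¹' {y}).Finite := by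
  have hc : ∀ m, IsCompact (accumulate A m) := isCompact_accumulate hA
  have := eventually_finite_fibers hc monotone_accumulate fun m =>
    indBelow.avoids (hc m) (h.subset (accumulate_subset_iUnion m))
  rwa [iUnion_accumulate] at this

lemma IsDimension.eventually_fiber_le {dim : Set K → EReal} (hdim : IsDimension dim) (n : ℕ) :
    ∀ᶠ f : C(K, Fin n → ℝ) in residual _, ∀ y,
      dim (f ⁻¹' {y}) ≤ max 0 (dStar dim n univ) := by
  have hne : {d : EReal | ∃ F : Set K, IsFSigmaIn F univ ∧ tdim F ≤ (n : EReal) - 1 ∧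
      d = dim (univ \ F)}.Nonempty :=
    ⟨_, ∅, ⟨fun _ => ∅, fun _ => isClosed_empty, by simp⟩,
      tdim_le_iff.2 (indBelow_of_isEmpty n), rfl⟩
  obtain ⟨u, -, hu, hmem⟩ := exists_seq_tendsto_sInf hne (OrderBot.bddBelow _)
  choose F hF hFd huF using hmem
  have hev : ∀ᶠ f : C(K, Fin n → ℝ) in residual _, ∀ k y, dim (f ⁻¹' {y}) ≤ max 0 (u k) := by
    refine eventually_countable_forall.2 fun k => ?_
    obtain ⟨C, hC, hFC⟩ := hF k
    simp only [inter_univ] at hFC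
    filter_upwards [eventually_finite_fibers_of_indBelow (fun i => (hC i).isCompact)
      (hFC ▸ tdim_le_iff.1 (hFd k))] with f hf y
    rw [huF k, hFC]
    exact hdim.le_of_diff_finite (isClosed_singleton.preimage f.continuous) (hf y)
      fun x hx => ⟨mem_univ x, fun hx' => hx.2 ⟨hx', hx.1⟩⟩
  filter_upwards [hev] with f hf y
  exact ge_of_tendsto' (tendsto_const_nhds.max hu) fun k => hf k y

lemma IsDimension.dStar_eq_of_dense {dim : Set K → EReal} (hdim : IsDimension dim) {n : ℕ}
    (hn : 0 < n) (hK : 0 < dStar dim n (univ : Set K))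
    (h : ∀ᶠ f : C(K, Fin n → ℝ) in residual _,
      range f ⊆ closure {y ∈ range f | dim (f ⁻¹' {y}) = dStar dim n univ})
    {U : Set K} (hU : IsOpen U) (hne : U.Nonempty) : dStar dim n U = dStar dim n univ := by
  refine le_antisymm (hdim.dStar_mono n (subset_univ U)) (not_lt.1 fun hlt => ?_)
  obtain ⟨d, ⟨F, ⟨C, hC, rfl⟩, hF, rfl⟩, hd⟩ := sInf_lt_iff.1 hlt
  obtain ⟨x₀, hx₀⟩ := hne
  obtain ⟨r, hr, hrU⟩ := Metric.isOpen_iff.1 hU x₀ hx₀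
  have hBU : closedBall x₀ (3 * r / 4) ⊆ U :=
    (closedBall_subset_ball (by linarith)).trans hrU
  have hsub : ⋃ i, C i ∩ closedBall x₀ (3 * r / 4) ⊆ ⋃ i, C i ∩ U :=
    iUnion_mono fun i => inter_subset_inter_right _ hBU
  have hfin := eventually_finite_fibers_of_indBelow (n := n)
    (A := fun i => C i ∩ closedBall x₀ (3 * r / 4))
    (fun i => ((hC i).inter isClosed_closedBall).isCompact) ((tdim_le_iff.1 hF).subset hsub)
  set f₀ : C(K, Fin n → ℝ) := ⟨fun x _ => dist x x₀, by fun_prop⟩ with hf₀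
  obtain ⟨f, ⟨hfR, hff⟩, hfd⟩ := (dense_of_mem_residual (h.and hfin)).exists_dist_lt f₀
    (show 0 < r / 4 by linarith)
  obtain ⟨y, ⟨-, hyd⟩, hyf⟩ := Metric.mem_closure_iff.1 (hfR ⟨x₀, rfl⟩) (r / 4) (by linarith)
  have hfx : ∀ x, |dist x x₀ - f x ⟨0, hn⟩| ≤ r / 4 := fun x =>
    ((dist_le_pi_dist (f₀ x) (f x) ⟨0, hn⟩).trans (ContinuousMap.dist_apply_le_dist x)).trans
      hfd.le
  have hfib : f ⁻¹' {y} ⊆ closedBall x₀ (3 * r / 4) := by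
    intro x hx
    have h1 := abs_le.1 (hfx x)
    have h2 := abs_le.1 (hfx x₀)
    have h3 := abs_lt.1 ((dist_le_pi_dist (f x₀) y ⟨0, hn⟩).trans_lt hyf)
    have h4 : f x ⟨0, hn⟩ = y ⟨0, hn⟩ := congrFun hx _
    rw [dist_self] at h2
    rw [mem_closedBall]
    linarith [h1.2, h2.1, h3.1]
  have hle := hdim.le_of_diff_finite (B := U \ ⋃ i, C i ∩ U)
    (isClosed_singleton.preimage f.continuous) (hff y) (fun x hx => by
      refine ⟨hBU (hfib hx.1), fun hx' => hx.2 ⟨?_, hx.1⟩⟩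
      obtain ⟨i, hi⟩ := mem_iUnion.1 hx'
      exact mem_iUnion.2 ⟨i, hi.1, hfib hx.1⟩)
  exact absurd (hyd ▸ hle) (not_le.2 (max_lt hK hd))

end UpperBounds

/-- Characterization of spaces where generically the fibers of maximal dimension are dense
in the image. -/
theorem stmt10 (n : ℕ) (hn : 0 < n) (K : Type*) [MetricSpace K] [CompactSpace K]
    (dimStar : Set K → EReal)
    (hdimStar : dimStar = tdim ∨ dimStar = hdim ∨ dimStar = pdim)
    (hK : 0 < dStar dimStar n (Set.univ : Set K)) :
    ((∀ᶠ (f : C(K, Fin n → ℝ)) in residual C(K, Fin n → ℝ),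
        {y ∈ Set.range ⇑f | dimStar (⇑f ⁻¹' {y}) = dStar dimStar n Set.univ}
          = interior (Set.range ⇑f) ∧
        Set.range ⇑f ⊆ closure (interior (Set.range ⇑f))) ↔
      (∀ U : Set K, IsOpen U → U.Nonempty →
        dStar dimStar n U = dStar dimStar n Set.univ)) ∧
    ((∀ᶠ (f : C(K, Fin n → ℝ)) in residual C(K, Fin n → ℝ),
        Set.range ⇑f ⊆
          closure {y ∈ Set.range ⇑f | dimStar (⇑f ⁻¹' {y}) = dStar dimStar n Set.univ}) ↔
      (∀ U : Set K, IsOpen U → U.Nonempty →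
        dStar dimStar n U = dStar dimStar n Set.univ)) := by
  have hD : IsDimension dimStar := by
    rcases hdimStar with rfl | rfl | rfl
    exacts [isDimension_tdim, isDimension_hdim, isDimension_pdim]
  have h21 : (∀ᶠ f : C(K, Fin n → ℝ) in residual C(K, Fin n → ℝ),
        {y ∈ range ⇑f | dimStar (⇑f ⁻¹' {y}) = dStar dimStar n univ} = interior (range ⇑f) ∧
          range ⇑f ⊆ closure (interior (range ⇑f))) →
      ∀ᶠ f : C(K, Fin n → ℝ) in residual C(K, Fin n → ℝ),
        range ⇑f ⊆ closure {y ∈ range ⇑f | dimStar (⇑f ⁻¹' {y}) = dStar dimStar n univ} :=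
    fun h => h.mono fun f hf => hf.1 ▸ hf.2
  have h32 (h : ∀ᶠ f : C(K, Fin n → ℝ) in residual C(K, Fin n → ℝ),
      range ⇑f ⊆ closure {y ∈ range ⇑f | dimStar (⇑f ⁻¹' {y}) = dStar dimStar n univ})
      (U : Set K) (hU : IsOpen U) (hne : U.Nonempty) :
      dStar dimStar n U = dStar dimStar n univ := hD.dStar_eq_of_dense hn hK h hU hne
  have h13 (h : ∀ U : Set K, IsOpen U → U.Nonempty → dStar dimStar n U = dStar dimStar n univ) :
      ∀ᶠ f : C(K, Fin n → ℝ) in residual C(K, Fin n → ℝ),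
        {y ∈ range ⇑f | dimStar (⇑f ⁻¹' {y}) = dStar dimStar n univ} = interior (range ⇑f) ∧
          range ⇑f ⊆ closure (interior (range ⇑f)) := by
    have hlow : ∀ᶠ f : C(K, Fin n → ℝ) in residual C(K, Fin n → ℝ), ∀ y ∈ interior (range ⇑f),
        dStar dimStar n univ ≤ dimStar (⇑f ⁻¹' {y}) := by
      have h' : ∀ V : Set K, IsOpen V → V.Nonempty →
          dStar dimStar n univ ≤ dStar dimStar n V := fun V hV hne => (h V hV hne).ge
      rcases hdimStar with rfl | rfl | rfl
      exacts [eventually_le_tdim_fiber h', eventually_le_hdim_fiber hK h',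
        eventually_le_pdim_fiber hK h']
    filter_upwards [hlow, hD.eventually_fiber_le n, eventually_finite_or_mem_interior
      fun V hV hne => not_indBelow_of_dStar_pos hD.empty_le (hK.trans_le (h V hV hne).ge)]
      with f h1 h2 h3
    rw [max_eq_right hK.le] at h2
    refine ⟨Subset.antisymm (fun y hy => ?_) fun y hy => ⟨interior_subset hy,
      le_antisymm (h2 y) (h1 y hy)⟩, h3.2⟩
    by_contra hyi
    exact absurd (hy.2 ▸ hD.finite_le (h3.1 y hyi)) (not_le.2 hK)
  exact ⟨⟨fun h => h32 (h21 h), h13⟩, ⟨h32, fun h => h21 (h13 h)⟩⟩
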